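/- arXiv:1611.06290 — 8 statements merged into one kernel-verified Lean document; each statement's English description precedes it below -/
import Mathlib

section
/- Let A and B be commutative rings that are finitely generated as ℤ-algebras and domains, and let f : A → B be an injective ring homomorphism making B into a finitely generated A-module. Then there exists a positive integer N such that for every prime p > N the following holds: for every Frobenius splitting φ on A/pA and every Frobenius splitting ψ on B/pB such that ψ(f̄(a)) = f̄(φ(a)) for all a ∈ A/pA (where f̄ : A/pA → B/pB is the map induced by f), and for every radical ideal I of A/pA with φ(I) ⊆ I, the radical of the ideal of B/pB generated by f̄(I) satisfies ψ(√(f̄(I)·(B/pB))) ⊆ √(f̄(I)·(B/pB)). -/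
/-- The ring homomorphism `A/pA → B/pB` induced by a ring homomorphism `f : A → B`. -/
def reduceModP {A B : Type*} [CommRing A] [CommRing B] (f : A →+* B) (p : ℕ) :
    A ⧸ Ideal.span {(p : A)} →+* B ⧸ Ideal.span {(p : B)} :=
  Ideal.quotientMap _ f (by
    rw [Ideal.span_le]
    intro x hx
    rw [Set.mem_singleton_iff] at hx
    subst hx
    rw [SetLike.mem_coe, Ideal.mem_comap, map_natCast]
    exact Ideal.mem_span_singleton_self _)

/-- A Frobenius splitting of a ring in characteristic `p`: an additive, `p⁻¹`-linear map
sending `1` to `1`. -/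
structure IsFrobeniusSplitting {R : Type*} [CommRing R] (p : ℕ) (φ : R → R) : Prop where
  apply_add : ∀ a b, φ (a + b) = φ a + φ b
  apply_pow_mul : ∀ a b, φ (a ^ p * b) = a * φ b
  apply_one : φ 1 = 1

namespace IsFrobeniusSplitting

variable {R : Type*} [CommRing R] {p : ℕ} {φ : R → R}

theorem isRadical (hφ : IsFrobeniusSplitting p φ) (hp : 1 < p) {I : Ideal R}
    (hI : ∀ x ∈ I, φ x ∈ I) : I.IsRadical := by
  refine (Ideal.isRadical_iff_pow_one_lt p hp).2 fun r hr => ?_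
  have h := hφ.apply_pow_mul r 1
  rw [mul_one, hφ.apply_one, mul_one] at h
  exact h ▸ hI _ hr

theorem exists_quotient (hφ : IsFrobeniusSplitting p φ) {I : Ideal R}
    (hI : ∀ x ∈ I, φ x ∈ I) :
    ∃ φ' : R ⧸ I → R ⧸ I, IsFrobeniusSplitting p φ' ∧
      ∀ x, φ' (Ideal.Quotient.mk I x) = Ideal.Quotient.mk I (φ x) := by
  let F : R →+ R := AddMonoidHom.mk' φ hφ.apply_add
  refine ⟨QuotientAddGroup.map I.toAddSubgroup I.toAddSubgroup F hI, ⟨_root_.map_add _, ?_, ?_⟩,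
    fun x => rfl⟩
  · rintro ⟨a⟩ ⟨b⟩
    exact congrArg (Ideal.Quotient.mk I) (hφ.apply_pow_mul a b)
  · exact congrArg (Ideal.Quotient.mk I) hφ.apply_one

end IsFrobeniusSplitting

section Newton

variable {R E σ : Type*} [CommRing R] [CommRing E] [Algebra R E] [Fintype σ]

open Finset in
theorem MvPolynomial.exists_algebraMap_eq_aeval_esymm {p : ℕ} [Fact p.Prime] [CharP R p]
    (I : Ideal R) (x : σ → E)
    (h : ∀ k, 0 < k → ∃ r ∈ I, algebraMap R E r = ∑ i, x i ^ k) (k : ℕ) (hk : 0 < k)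
    (hkp : k < p) : ∃ r ∈ I, algebraMap R E r = aeval x (esymm σ ℤ k) := by
  induction k using Nat.strong_induction_on with
  | _ k ih =>
  have key : ∃ r ∈ I, algebraMap R E r = k * aeval x (esymm σ ℤ k) := by
    have hN := congrArg (aeval x) (mul_esymm_eq_sum σ ℤ k)
    rw [map_mul, map_natCast] at hN
    rw [hN]
    change _ ∈ (Submodule.map (Algebra.linearMap R E) I)
    rw [map_mul, map_sum, map_pow, map_neg, map_one]
    have hneg (m : ℕ) (z : E) (hz : z ∈ Submodule.map (Algebra.linearMap R E) I) :
        (-1) ^ m * z ∈ Submodule.map (Algebra.linearMap R E) I := by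
      rcases neg_one_pow_eq_or E m with h | h <;> simpa [h] using hz
    refine hneg _ _ (Submodule.sum_mem _ fun a ha => ?_)
    obtain ⟨ha, hak⟩ := mem_filter.1 ha
    rw [HasAntidiagonal.mem_antidiagonal] at ha
    obtain ⟨r, hr, hr'⟩ := h a.2 (by omega)
    rw [map_mul, map_mul, map_pow, map_neg, map_one, mul_assoc]
    refine hneg _ _ ?_
    simp only [psum, map_sum, map_pow, aeval_X, ← hr']
    rcases Nat.eq_zero_or_pos a.1 with h0 | h0
    · rw [h0, esymm_zero, map_one, one_mul]
      exact ⟨r, hr, rfl⟩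
    · obtain ⟨r₁, hr₁, hr₁'⟩ := ih a.1 hak h0 (by omega)
      rw [← hr₁', ← map_mul]
      exact ⟨_, I.mul_mem_left _ hr, rfl⟩
  have hu : IsUnit (k : R) := by
    rw [CharP.isUnit_natCast_iff (p := p) Fact.out]
    exact Nat.not_dvd_of_pos_of_lt hk hkp
  obtain ⟨u, hu⟩ := hu
  obtain ⟨r, hr, hr'⟩ := key
  refine ⟨↑u⁻¹ * r, I.mul_mem_left _ hr, ?_⟩
  rw [map_mul, hr', ← map_natCast (algebraMap R E), ← hu, ← mul_assoc, ← map_mul,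
    Units.inv_mul, map_one, one_mul]

open Finset in
theorem MvPolynomial.sum_aeval_esymm_mul_pow_eq_zero (x : σ → E) (i : σ) :
    ∑ j ∈ range (Fintype.card σ + 1),
      (-1) ^ j * (aeval x (esymm σ ℤ j) * x i ^ (Fintype.card σ - j)) = 0 := by
  have h := congrArg (Polynomial.eval (x i))
    (Multiset.prod_X_sub_X_eq_sum_esymm (univ.val.map x))
  simp only [Polynomial.eval_finsetSum, Polynomial.eval_mul, Polynomial.eval_pow,
    Polynomial.eval_neg, Polynomial.eval_one, Polynomial.eval_C, Polynomial.eval_X,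
    Multiset.card_map, card_val, card_univ] at h
  simp_rw [aeval_esymm_eq_multiset_esymm]
  rw [← h, Multiset.map_map, ← Finset.prod, Polynomial.eval_prod]
  exact prod_eq_zero (mem_univ i) (by simp)

/-- If all positive power sums of a family of fewer than `p` conjugates of `s` lie in `I`, then some
power of `s` lies in the extension of `I`. -/
theorem Ideal.mem_radical_map_of_sum_pow {S : Type*} [CommRing S] [Algebra R S] [Algebra S E]
    [IsScalarTower R S E] [FaithfulSMul S E] {p : ℕ} [Fact p.Prime] [CharP R p]
    (hp : Fintype.card σ < p) (I : Ideal R) (x : σ → E) (i : σ) (s : S)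
    (hi : x i = algebraMap S E s)
    (h : ∀ k, 0 < k → ∃ r ∈ I, algebraMap R E r = ∑ i, x i ^ k) :
    s ∈ (I.map (algebraMap R S)).radical := by
  have key := MvPolynomial.sum_aeval_esymm_mul_pow_eq_zero x i
  rw [Finset.sum_range_succ', MvPolynomial.esymm_zero] at key
  simp only [pow_zero, map_one, one_mul, Nat.sub_zero] at key
  have : ∃ z ∈ I.map (algebraMap R S), algebraMap S E z =
      ∑ j ∈ Finset.range (Fintype.card σ), (-1) ^ (j + 1) *
        (MvPolynomial.aeval x (MvPolynomial.esymm σ ℤ (j + 1)) *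
          x i ^ (Fintype.card σ - (j + 1))) := by
    change _ ∈ Submodule.map (Algebra.linearMap S E) (I.map (algebraMap R S))
    refine Submodule.sum_mem _ fun j hj => ?_
    obtain ⟨r, hr, hr'⟩ := MvPolynomial.exists_algebraMap_eq_aeval_esymm I x h (j + 1)
      j.succ_pos (by have := Finset.mem_range.1 hj; omega)
    refine ⟨(-1) ^ (j + 1) * (algebraMap R S r * s ^ (Fintype.card σ - (j + 1))),
      Ideal.mul_mem_left _ _ (Ideal.mul_mem_right _ _ (Ideal.mem_map_of_mem _ hr)), ?_⟩
    simp [← hr', hi, ← IsScalarTower.algebraMap_apply]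
  obtain ⟨z, hz, hz'⟩ := this
  rw [← hz', hi, ← map_pow, ← map_add] at key
  have := (FaithfulSMul.algebraMap_injective S E) (key.trans (map_zero _).symm)
  exact ⟨Fintype.card σ, by
    rw [eq_neg_of_add_eq_zero_right this]; exact neg_mem hz⟩

end Newton

section TraceIdeal

variable {R S K : Type*} [CommRing R] [CommRing S] [Algebra R S] [Field K] [Algebra R K]

/-- The ideal of all `s : S` such that a given functional maps `s * S` into `I`. -/
def traceIdeal (τ : S →ₗ[R] K) (I : Ideal R) : Ideal S where
  carrier := {s | ∀ t, τ (s * t) ∈ Submodule.map (Algebra.linearMap R K) I}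
  zero_mem' t := by simp
  add_mem' ha hb t := by rw [add_mul, map_add]; exact add_mem (ha t) (hb t)
  smul_mem' c s hs t := by rw [smul_eq_mul, mul_comm c, mul_assoc]; exact hs _

theorem mem_traceIdeal {τ : S →ₗ[R] K} {I : Ideal R} {s : S} :
    s ∈ traceIdeal τ I ↔ ∀ t, ∃ r ∈ I, algebraMap R K r = τ (s * t) := Iff.rfl

/-- The ideal of all `c : R` such that `c • τ` takes values in `R`. -/
def traceConductor (τ : S →ₗ[R] K) : Ideal R where
  carrier := {c | ∀ s, c • τ s ∈ LinearMap.range (Algebra.linearMap R K)}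
  zero_mem' t := by simp
  add_mem' ha hb t := by rw [add_smul]; exact add_mem (ha t) (hb t)
  smul_mem' c s hs t := by rw [smul_assoc]; exact Submodule.smul_mem _ _ (hs t)

theorem mem_traceConductor {τ : S →ₗ[R] K} {c : R} :
    c ∈ traceConductor τ ↔ ∀ s, ∃ r, algebraMap R K r = c • τ s := Iff.rfl

theorem map_traceConductor_mul_le (τ : S →ₗ[R] K) (I : Ideal R) :
    (traceConductor τ).map (algebraMap R S) * I.map (algebraMap R S) ≤ traceIdeal τ I := by
  rw [← Ideal.map_mul, Ideal.map_le_iff_le_comap, Ideal.mul_le]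
  intro c hc i hi
  rw [Ideal.mem_comap, mem_traceIdeal]
  intro t
  obtain ⟨r, hr⟩ := mem_traceConductor.1 hc t
  refine ⟨i * r, I.mul_mem_right _ hi, ?_⟩
  rw [← Algebra.smul_def, mul_comm c, map_smul, mul_smul, ← hr, map_mul,
    Algebra.smul_def]

variable [FaithfulSMul R K] {p : ℕ} {φ : R → R} {ψ : S → S}

theorem IsFrobeniusSplitting.map_trace [IsDomain R] (hφ : IsFrobeniusSplitting p φ)
    (hψ : IsFrobeniusSplitting p ψ) (hφψ : ∀ a, ψ (algebraMap R S a) = algebraMap R S (φ a))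
    (hp : p ≠ 0) (τ : S →ₗ[R] K) (hτ : ∀ s, τ (s ^ p) = τ s ^ p) (hC : traceConductor τ ≠ ⊥)
    (hspan : ∀ s : S, ∃ d : R, d ≠ 0 ∧ d • s ∈ Submodule.span R (Set.range fun t : S => t ^ p))
    {s : S} {r : R} (h : algebraMap R K r = τ s) : algebraMap R K (φ r) = τ (ψ s) := by
  have hinj := FaithfulSMul.algebraMap_injective R K
  obtain ⟨e, he, he0⟩ := Submodule.exists_mem_ne_zero_of_ne_bot hC
  obtain ⟨d, hd0, hd⟩ := hspan s
  have hφ0 : φ 0 = 0 := by simpa using hφ.apply_add 0 0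
  have hψ0 : ψ 0 = 0 := by simpa using hψ.apply_add 0 0
  have hψs (a : R) (s : S) : ψ (a ^ p • s) = a • ψ s := by
    rw [Algebra.smul_def, map_pow, hψ.apply_pow_mul, Algebra.smul_def]
  have key (z : S) (hz : z ∈ Submodule.span R (Set.range fun t : S => t ^ p)) :
      ∀ a : R, ∃ r, algebraMap R K r = τ ((e ^ p * a) • z) ∧
        algebraMap R K (φ r) = τ (ψ ((e ^ p * a) • z)) := by
    induction hz using Submodule.span_induction with
    | mem z hz =>
      intro a
      obtain ⟨t, rfl⟩ := hz
      obtain ⟨w, hw⟩ := mem_traceConductor.1 he t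
      refine ⟨w ^ p * a, ?_, ?_⟩
      · rw [map_smul, hτ, map_mul, map_pow, hw, Algebra.smul_def, Algebra.smul_def, map_mul,
          map_pow]
        ring
      · rw [hφ.apply_pow_mul]
        have : (e ^ p * a) • t ^ p = (e • t) ^ p * algebraMap R S a := by
          rw [Algebra.smul_def, Algebra.smul_def, map_mul, map_pow]
          ring
        dsimp only
        rw [this, hψ.apply_pow_mul, hφψ, mul_comm (e • t), ← Algebra.smul_def, map_smul, map_smul,
          ← hw, mul_comm, map_mul, Algebra.smul_def, mul_comm]
    | zero => exact fun a => ⟨0, by simp [hφ0, hψ0]⟩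
    | add x y _ _ hx hy =>
      intro a
      obtain ⟨r, hr, hr'⟩ := hx a
      obtain ⟨q, hq, hq'⟩ := hy a
      refine ⟨r + q, ?_, ?_⟩
      · rw [map_add, hr, hq, smul_add, map_add]
      · rw [hφ.apply_add, map_add, hr', hq', smul_add, hψ.apply_add, map_add]
    | smul b z _ hz =>
      intro a
      simpa only [smul_smul, mul_assoc] using hz (a * b)
  obtain ⟨r', hr, hr'⟩ := key _ hd (d ^ (p - 1))
  have hde : (e ^ p * d ^ (p - 1)) • d • s = (e * d) ^ p • s := by
    rw [smul_smul, mul_assoc, ← pow_succ, Nat.sub_add_cancel (Nat.pos_of_ne_zero hp), mul_pow]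
  rw [hde, map_smul, ← h, Algebra.smul_def, ← map_mul] at hr
  rw [hde, hinj hr, hφ.apply_pow_mul, hψs, map_smul, Algebra.smul_def, map_mul] at hr'
  exact mul_left_cancel₀ (by simpa using ⟨he0, hd0⟩) hr'

theorem IsFrobeniusSplitting.exists_le_radical_map [IsDomain R] (hφ : IsFrobeniusSplitting p φ)
    (hψ : IsFrobeniusSplitting p ψ) (hφψ : ∀ a, ψ (algebraMap R S a) = algebraMap R S (φ a))
    (hp : 1 < p) (τ : S →ₗ[R] K) (hτ : ∀ s, τ (s ^ p) = τ s ^ p) (hC : traceConductor τ ≠ ⊥)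
    (hspan : ∀ s : S, ∃ d : R, d ≠ 0 ∧ d • s ∈ Submodule.span R (Set.range fun t : S => t ^ p))
    (hrad : ∀ (I : Ideal R) (s : S), (∀ k, 0 < k → ∃ r ∈ I, algebraMap R K r = τ (s ^ k)) →
      s ∈ (I.map (algebraMap R S)).radical) :
    ∃ C : Ideal R, C ≠ ⊥ ∧
      (∀ y ∈ (C.map (algebraMap R S)).radical, ψ y ∈ (C.map (algebraMap R S)).radical) ∧
      ∀ I : Ideal R, (∀ x ∈ I, φ x ∈ I) → ∃ G : Ideal S, (∀ y ∈ G, ψ y ∈ G) ∧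
        (C.map (algebraMap R S)).radical ⊓ (I.map (algebraMap R S)).radical ≤ G ∧
        G ≤ (I.map (algebraMap R S)).radical := by
  have hG (I : Ideal R) (hI : ∀ x ∈ I, φ x ∈ I) :
      (∀ y ∈ traceIdeal τ I, ψ y ∈ traceIdeal τ I) ∧
        ((traceConductor τ).map (algebraMap R S)).radical ⊓ (I.map (algebraMap R S)).radical ≤
          traceIdeal τ I ∧
        traceIdeal τ I ≤ (I.map (algebraMap R S)).radical := by
    have hGψ : ∀ y ∈ traceIdeal τ I, ψ y ∈ traceIdeal τ I := by
      refine fun y hy => mem_traceIdeal.2 fun t => ?_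
      obtain ⟨r, hr, hr'⟩ := mem_traceIdeal.1 hy (t ^ p)
      refine ⟨φ r, hI r hr, ?_⟩
      rw [hφ.map_trace hψ hφψ (by omega) τ hτ hC hspan hr', mul_comm, hψ.apply_pow_mul, mul_comm]
    refine ⟨hGψ, ?_, fun s hs => hrad I s fun k hk => ?_⟩
    · rw [← Ideal.radical_mul, ← (hψ.isRadical hp hGψ).radical]
      exact Ideal.radical_mono (map_traceConductor_mul_le τ I)
    · obtain ⟨r, hr, hr'⟩ := mem_traceIdeal.1 hs (s ^ (k - 1))
      refine ⟨r, hr, ?_⟩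
      rw [hr', ← pow_succ', Nat.sub_add_cancel hk]
  refine ⟨traceConductor τ, hC, ?_, fun I hI => ⟨_, hG I hI⟩⟩
  obtain ⟨h₁, h₂, h₃⟩ := hG (traceConductor τ) fun c hc => mem_traceConductor.2 fun s => by
    obtain ⟨d, hd, hd0⟩ := Submodule.exists_mem_ne_zero_of_ne_bot hC
    obtain ⟨w, hw⟩ := mem_traceConductor.1 hd s
    obtain ⟨r, hr⟩ := mem_traceConductor.1 hc (s ^ p)
    have hdr : d ^ p * r = w ^ p * c := by
      apply FaithfulSMul.algebraMap_injective R K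
      rw [map_mul, map_mul, map_pow, map_pow, hr, hw, hτ, Algebra.smul_def, Algebra.smul_def]
      ring
    have hdr' := congrArg (algebraMap R K ∘ φ) hdr
    simp only [Function.comp_apply, hφ.apply_pow_mul, map_mul, hw, Algebra.smul_def] at hdr'
    refine ⟨φ r, mul_left_cancel₀ (a := algebraMap R K d) (by simpa using hd0) ?_⟩
    rw [hdr', Algebra.smul_def]
    ring
  rw [inf_idem] at h₂
  rwa [le_antisymm h₂ h₃]

end TraceIdeal

section Fields

variable {K L : Type*} [Field K] [Field L] [Algebra K L] [FiniteDimensional K L]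

theorem Algebra.IsSeparable.of_finrank_lt (p : ℕ) [Fact p.Prime] [CharP K p]
    (h : Module.finrank K L < p) : Algebra.IsSeparable K L := by
  have : ExpChar K p := ExpChar.prime Fact.out
  rw [isSeparable_iff_finInsepDegree_eq_one]
  obtain ⟨n, hn⟩ := finInsepDegree_eq_pow (F := K) (E := L) p
  have hle : Field.finInsepDegree K L ≤ Module.finrank K L :=
    Nat.le_of_dvd Module.finrank_pos
      (Dvd.intro_left _ (Field.finSepDegree_mul_finInsepDegree K L))
  rcases n with _ | n
  · simpa using hn
  · have := Nat.le_self_pow n.succ_ne_zero p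
    exact absurd (this.trans (hn ▸ hle)) h.not_ge

theorem Algebra.trace_pow_char [Algebra.IsSeparable K L] (p : ℕ) [Fact p.Prime] [CharP K p]
    (x : L) : Algebra.trace K L (x ^ p) = Algebra.trace K L x ^ p := by
  apply FaithfulSMul.algebraMap_injective K (AlgebraicClosure L)
  have : CharP (AlgebraicClosure L) p := charP_of_injective_algebraMap' K p
  rw [map_pow (algebraMap K _), trace_eq_sum_embeddings (AlgebraicClosure L),
    trace_eq_sum_embeddings (AlgebraicClosure L), sum_pow_char]
  simp

end Fields

section Domains

open scoped nonZeroDivisors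

variable {R S : Type*} [CommRing R] [IsDomain R] [CommRing S] [Algebra R S]
  {p : ℕ} [Fact p.Prime] [CharP R p] {φ : R → R} {ψ : S → S}

theorem IsFrobeniusSplitting.exists_le_radical_map_of_isFractionRing (K L : Type*) [Field K]
    [Field L] [Algebra R K] [IsFractionRing R K] [Algebra S L] [FaithfulSMul S L] [Algebra K L]
    [Algebra R L] [IsScalarTower R K L] [IsScalarTower R S L]
    [IsLocalization (Algebra.algebraMapSubmonoid S R⁰) L] (hφ : IsFrobeniusSplitting p φ)
    (hψ : IsFrobeniusSplitting p ψ) (hφψ : ∀ a, ψ (algebraMap R S a) = algebraMap R S (φ a))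
    {n : ℕ} (hn : n < p) (g : Fin n → S) (hg : Submodule.span R (Set.range g) = ⊤) :
    ∃ C : Ideal R, C ≠ ⊥ ∧
      (∀ y ∈ (C.map (algebraMap R S)).radical, ψ y ∈ (C.map (algebraMap R S)).radical) ∧
      ∀ I : Ideal R, (∀ x ∈ I, φ x ∈ I) → ∃ G : Ideal S, (∀ y ∈ G, ψ y ∈ G) ∧
        (C.map (algebraMap R S)).radical ⊓ (I.map (algebraMap R S)).radical ≤ G ∧
        G ≤ (I.map (algebraMap R S)).radical := by
  have : CharP K p := charP_of_injective_algebraMap' R p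
  have hspanL : Submodule.span K (Set.range (algebraMap S L ∘ g)) = ⊤ := by
    rw [Set.range_comp]
    exact span_eq_top_localization_localization K R⁰ L hg
  have : FiniteDimensional K L :=
    Module.finite_def.2 (hspanL ▸ Submodule.fg_span (Set.finite_range _))
  have hfinrank : Module.finrank K L < p := by
    have h := finrank_range_le_card (R := K) (algebraMap S L ∘ g)
    rw [Set.finrank, hspanL, finrank_top, Fintype.card_fin] at h
    omega
  have hsep : Algebra.IsSeparable K L := .of_finrank_lt p hfinrank
  let τ : S →ₗ[R] K := (Algebra.trace K L).restrictScalars R ∘ₗ (IsScalarTower.toAlgHom R S L)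
  have hτ (s : S) : τ s = Algebra.trace K L (algebraMap S L s) := rfl
  refine hφ.exists_le_radical_map hψ hφψ (Fact.out : p.Prime).one_lt τ ?_ ?_ ?_ ?_
  · intro s
    rw [hτ, hτ, map_pow, Algebra.trace_pow_char p]
  · obtain ⟨b, hb⟩ := IsLocalization.exist_integer_multiples_of_finite R⁰ (τ ∘ g)
    refine (Submodule.ne_bot_iff _).2 ⟨b, mem_traceConductor.2 fun s => ?_,
      nonZeroDivisors.ne_zero b.2⟩
    have hs : s ∈ Submodule.span R (Set.range g) := hg ▸ Submodule.mem_top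
    change (b : R) • τ s ∈ LinearMap.range (Algebra.linearMap R K)
    induction hs using Submodule.span_induction with
    | mem z hz =>
      obtain ⟨i, rfl⟩ := hz
      exact hb i
    | zero => simp
    | add x y _ _ hx hy => rw [map_add, smul_add]; exact add_mem hx hy
    | smul a x _ hx => rw [map_smul, smul_comm]; exact Submodule.smul_mem _ _ hx
  · intro s
    have : ExpChar K p := ExpChar.prime Fact.out
    have hpow := Field.span_map_pow_expChar_pow_eq_top_of_isSeparable p 1 hspanL
    have hs : algebraMap S L s ∈
        Submodule.span K (Set.range ((algebraMap S L ∘ g) · ^ p ^ 1)) := hpow ▸ Submodule.mem_top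
    obtain ⟨c, hc⟩ := (Submodule.mem_span_range_iff_exists_fun K).1 hs
    obtain ⟨b, hb⟩ := IsLocalization.exist_integer_multiples_of_finite R⁰ c
    choose r hr using hb
    refine ⟨b, nonZeroDivisors.ne_zero b.2, ?_⟩
    have : (b : R) • s = ∑ i, r i • g i ^ p := by
      apply FaithfulSMul.algebraMap_injective S L
      rw [Algebra.smul_def, map_mul, ← hc, map_sum, Finset.mul_sum,
        ← IsScalarTower.algebraMap_apply]
      refine Finset.sum_congr rfl fun i _ => ?_
      rw [Algebra.smul_def (r i), map_mul, ← IsScalarTower.algebraMap_apply,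
        IsScalarTower.algebraMap_apply R K L (r i), hr, Algebra.smul_def (b : R), map_mul,
        ← IsScalarTower.algebraMap_apply, Algebra.smul_def (c i), map_pow, mul_assoc, pow_one]
      rfl
    rw [this]
    exact Submodule.sum_mem _ fun i _ =>
      Submodule.smul_mem _ _ (Submodule.subset_span ⟨g i, rfl⟩)
  · intro I s h
    let E := AlgebraicClosure L
    have : IsScalarTower R S E := .of_algebraMap_eq fun r => by
      rw [IsScalarTower.algebraMap_apply S L E, ← IsScalarTower.algebraMap_apply R S L,
        ← IsScalarTower.algebraMap_apply R L E]
    have : FaithfulSMul S E := (faithfulSMul_iff_algebraMap_injective S E).2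
      ((FaithfulSMul.algebraMap_injective L E).comp (FaithfulSMul.algebraMap_injective S L))
    refine Ideal.mem_radical_map_of_sum_pow (E := E) (p := p) (σ := L →ₐ[K] E) ?_ I
      (fun σ => σ (algebraMap S L s)) (IsScalarTower.toAlgHom K L E) s rfl fun k hk => ?_
    · rwa [AlgHom.card]
    · obtain ⟨r, hr, hr'⟩ := h k hk
      refine ⟨r, hr, ?_⟩
      rw [IsScalarTower.algebraMap_apply R K E, hr', hτ, trace_eq_sum_embeddings E]
      simp

variable [IsDomain S] [FaithfulSMul R S]

attribute [local instance] FractionRing.liftAlgebra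

theorem IsFrobeniusSplitting.exists_le_radical_map_of_span_eq_top (hφ : IsFrobeniusSplitting p φ)
    (hψ : IsFrobeniusSplitting p ψ) (hφψ : ∀ a, ψ (algebraMap R S a) = algebraMap R S (φ a))
    {n : ℕ} (hn : n < p) (g : Fin n → S) (hg : Submodule.span R (Set.range g) = ⊤) :
    ∃ C : Ideal R, C ≠ ⊥ ∧
      (∀ y ∈ (C.map (algebraMap R S)).radical, ψ y ∈ (C.map (algebraMap R S)).radical) ∧
      ∀ I : Ideal R, (∀ x ∈ I, φ x ∈ I) → ∃ G : Ideal S, (∀ y ∈ G, ψ y ∈ G) ∧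
        (C.map (algebraMap R S)).radical ⊓ (I.map (algebraMap R S)).radical ≤ G ∧
        G ≤ (I.map (algebraMap R S)).radical := by
  have : Module.Finite R S := ⟨hg ▸ Submodule.fg_span (Set.finite_range g)⟩
  exact hφ.exists_le_radical_map_of_isFractionRing (FractionRing R) (FractionRing S) hψ hφψ hn g hg

end Domains

section Induction

theorem Submodule.span_range_comp_eq_top {R S R' S' ι : Type*} [CommRing R] [CommRing S]
    [Algebra R S] [CommRing R'] [CommRing S'] [Algebra R' S'] (f : R →+* R') (g : S →+* S')
    (hg : Function.Surjective g) (h : ∀ r, g (algebraMap R S r) = algebraMap R' S' (f r))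
    (v : ι → S) (hv : span R (Set.range v) = ⊤) : span R' (Set.range (g ∘ v)) = ⊤ := by
  refine eq_top_iff'.2 fun x => ?_
  obtain ⟨s, rfl⟩ := hg x
  have hs : s ∈ span R (Set.range v) := hv ▸ mem_top
  induction hs using span_induction with
  | mem z hz =>
    obtain ⟨i, rfl⟩ := hz
    exact subset_span ⟨i, rfl⟩
  | zero => simp
  | add x y _ _ hx hy => rw [map_add]; exact add_mem hx hy
  | smul a x _ hx =>
    rw [Algebra.smul_def, map_mul, h, ← Algebra.smul_def]
    exact smul_mem _ _ hx

variable {R S : Type*} [CommRing R] [CommRing S] [Algebra R S]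

theorem Ideal.comap_mk_radical_map_map (T : Ideal S) (I : Ideal R) :
    (((I.map (Ideal.Quotient.mk (T.under R))).map
      (algebraMap (R ⧸ T.under R) (S ⧸ T))).radical).comap (Ideal.Quotient.mk T) =
      (I.map (algebraMap R S) ⊔ T).radical := by
  have h : (algebraMap (R ⧸ T.under R) (S ⧸ T)).comp (Ideal.Quotient.mk (T.under R)) =
      (Ideal.Quotient.mk T).comp (algebraMap R S) := rfl
  rw [Ideal.map_map, h, ← Ideal.map_map, Ideal.comap_radical,
    Ideal.comap_map_of_surjective' _ Ideal.Quotient.mk_surjective, Ideal.mk_ker]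

theorem Ideal.exists_lt_mul_le_of_not_isPrime {ψ : S → S} {p : ℕ}
    (hψ : IsFrobeniusSplitting p ψ) (hp : 1 < p) {T : Ideal S} (hT : ∀ x ∈ T, ψ x ∈ T)
    (hT' : T ≠ ⊤) (hprime : ¬ T.IsPrime) :
    ∃ T₁ T₂ : Ideal S, T < T₁ ∧ T < T₂ ∧ (∀ x ∈ T₁, ψ x ∈ T₁) ∧ (∀ x ∈ T₂, ψ x ∈ T₂) ∧
      T₁ * T₂ ≤ T := by
  obtain ⟨a, ha, b, hb, hab⟩ : ∃ a ∉ T, ∃ b ∉ T, a * b ∈ T := by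
    by_contra! h
    exact hprime ⟨hT', fun {x y} hxy => by
      by_contra! hne
      exact h x hne.1 y hne.2 hxy⟩
  have hcolon (J : Ideal S) : ∀ x ∈ T.colon (J : Set S), ψ x ∈ T.colon (J : Set S) := by
    intro x hx
    rw [Submodule.mem_colon] at hx ⊢
    intro y hy
    have := hT _ (hx (y ^ p) (J.pow_mem_of_mem hy p (by omega)))
    rwa [smul_eq_mul, mul_comm, hψ.apply_pow_mul, mul_comm] at this
  have hle (J : Ideal S) : T ≤ T.colon (J : Set S) := fun x hx =>
    Submodule.mem_colon.2 fun y _ => T.mul_mem_right y hx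
  refine ⟨T.colon (Ideal.span {a} : Ideal S), T.colon (T.colon (Ideal.span {a} : Ideal S)),
    lt_of_le_of_ne (hle _) fun h => hb ?_, lt_of_le_of_ne (hle _) fun h => ha ?_,
    hcolon _, hcolon _, ?_⟩
  · rw [h, Submodule.mem_colon]
    intro y hy
    obtain ⟨c, rfl⟩ := Ideal.mem_span_singleton'.1 hy
    rw [smul_eq_mul, mul_left_comm, mul_comm b]
    exact T.mul_mem_left _ hab
  · rw [h, Submodule.mem_colon]
    intro y hy
    rw [smul_eq_mul, mul_comm]
    exact Submodule.mem_colon.1 hy a (Ideal.mem_span_singleton_self a)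
  · rw [Ideal.mul_le]
    intro x hx y hy
    rw [mul_comm]
    exact Submodule.mem_colon.1 hy x hx

variable {p : ℕ} [Fact p.Prime] {φ : R → R} {ψ : S → S}

theorem IsFrobeniusSplitting.exists_le_radical_map_sup (hφ : IsFrobeniusSplitting p φ)
    (hψ : IsFrobeniusSplitting p ψ) (hφψ : ∀ a, ψ (algebraMap R S a) = algebraMap R S (φ a))
    (hpR : (p : R) = 0) {n : ℕ} (hn : n < p) (g : Fin n → S)
    (hg : Submodule.span R (Set.range g) = ⊤) (T : Ideal S) [T.IsPrime]
    (hT : ∀ x ∈ T, ψ x ∈ T) :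
    ∃ C : Ideal R, ¬ C.map (algebraMap R S) ≤ T ∧
      (∀ y ∈ (C.map (algebraMap R S) ⊔ T).radical, ψ y ∈ (C.map (algebraMap R S) ⊔ T).radical) ∧
      ∀ I : Ideal R, (∀ x ∈ I, φ x ∈ I) → ∃ G : Ideal S, (∀ y ∈ G, ψ y ∈ G) ∧
        (C.map (algebraMap R S) ⊔ T).radical ⊓ (I.map (algebraMap R S) ⊔ T).radical ≤ G ∧
        G ≤ (I.map (algebraMap R S) ⊔ T).radical := by
  obtain ⟨φ', hφ', hφφ'⟩ := hφ.exists_quotient (I := T.under R) fun x hx => by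
    rw [Ideal.mem_comap, ← hφψ]
    exact hT _ hx
  obtain ⟨ψ', hψ', hψψ'⟩ := hψ.exists_quotient hT
  have halg (a : R) : algebraMap (R ⧸ T.under R) (S ⧸ T) (Ideal.Quotient.mk _ a) =
      Ideal.Quotient.mk T (algebraMap R S a) := rfl
  have : CharP (R ⧸ T.under R) p := by
    have h : (p : R ⧸ T.under R) = 0 := by
      rw [← map_natCast (Ideal.Quotient.mk (T.under R)), hpR, map_zero]
    exact (CharP.charP_iff_prime_eq_zero Fact.out).2 h
  obtain ⟨C, hC, hCψ, hI⟩ := hφ'.exists_le_radical_map_of_span_eq_top hψ' (by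
    rintro ⟨a⟩
    change ψ' (algebraMap _ _ (Ideal.Quotient.mk _ a)) =
      algebraMap _ _ (φ' (Ideal.Quotient.mk _ a))
    rw [hφφ', halg, halg, hψψ', hφψ]) hn (Ideal.Quotient.mk T ∘ g)
    (Submodule.span_range_comp_eq_top (Ideal.Quotient.mk (T.under R)) (Ideal.Quotient.mk T)
      Ideal.Quotient.mk_surjective (fun _ => rfl) g hg)
  have hCC : (C.comap (Ideal.Quotient.mk (T.under R))).map (Ideal.Quotient.mk (T.under R)) = C :=
    Ideal.map_comap_of_surjective _ Ideal.Quotient.mk_surjective C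
  refine ⟨C.comap (Ideal.Quotient.mk (T.under R)), fun h => hC ?_, ?_, fun I hφI => ?_⟩
  · rw [← hCC, Ideal.map_eq_bot_iff_le_ker, Ideal.mk_ker]
    exact Ideal.map_le_iff_le_comap.1 h
  · rw [← Ideal.comap_mk_radical_map_map, hCC]
    intro y hy
    rw [Ideal.mem_comap, ← hψψ']
    exact hCψ _ hy
  · obtain ⟨G, hG, hCG, hGI⟩ := hI (I.map (Ideal.Quotient.mk (T.under R))) (by
      intro x hx
      obtain ⟨x, hx', rfl⟩ := (Ideal.mem_map_iff_of_surjective _ Ideal.Quotient.mk_surjective).1 hx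
      rw [hφφ']
      exact Ideal.mem_map_of_mem _ (hφI x hx'))
    refine ⟨G.comap (Ideal.Quotient.mk T), fun y hy => ?_, ?_, ?_⟩
    · rw [Ideal.mem_comap, ← hψψ']
      exact hG _ hy
    · rw [← Ideal.comap_mk_radical_map_map, ← Ideal.comap_mk_radical_map_map, hCC,
        ← Ideal.comap_inf]
      exact Ideal.comap_mono hCG
    · rw [← Ideal.comap_mk_radical_map_map]
      exact Ideal.comap_mono hGI

theorem IsFrobeniusSplitting.map_mem_radical_map_sup [IsNoetherianRing S]
    (hφ : IsFrobeniusSplitting p φ) (hψ : IsFrobeniusSplitting p ψ)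
    (hφψ : ∀ a, ψ (algebraMap R S a) = algebraMap R S (φ a))
    (hpR : (p : R) = 0) {n : ℕ} (hn : n < p) (g : Fin n → S)
    (hg : Submodule.span R (Set.range g) = ⊤) {I : Ideal R} (hI : ∀ x ∈ I, φ x ∈ I)
    (T : Ideal S) (hT : ∀ x ∈ T, ψ x ∈ T) :
    ∀ y ∈ (I.map (algebraMap R S) ⊔ T).radical, ψ y ∈ (I.map (algebraMap R S) ⊔ T).radical := by
  have hp : 1 < p := (Fact.out : p.Prime).one_lt
  induction T using WellFoundedGT.induction with
  | ind T ih =>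
  intro y hy
  rcases eq_or_ne T ⊤ with rfl | hTtop
  · simp [Ideal.radical_top]
  by_cases hprime : T.IsPrime
  · obtain ⟨C, hCT, hCψ, hG⟩ := hφ.exists_le_radical_map_sup hψ hφψ hpR hn g hg T hT
    set IS := I.map (algebraMap R S)
    set CS := C.map (algebraMap R S)
    have hlt : T < (CS ⊔ T).radical := lt_of_le_of_ne (le_sup_right.trans Ideal.le_radical)
      fun h => hCT (by rw [h]; exact le_sup_left.trans Ideal.le_radical)
    have h₁ := ih _ hlt hCψ y (Ideal.radical_mono (sup_le_sup_left hlt.le _) hy)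
    obtain ⟨G, hGψ, hCG, hGI⟩ := hG I hI
    have h₂ : ∀ c ∈ (CS ⊔ T).radical, c * ψ y ∈ (IS ⊔ T).radical := fun c hc => by
      rw [← hψ.apply_pow_mul]
      exact hGI (hGψ _ (hCG ⟨Ideal.mul_mem_right _ _ (Ideal.pow_mem_of_mem _ hc p (by omega)),
        Ideal.mul_mem_left _ _ hy⟩))
    obtain ⟨k, hk⟩ := h₁
    obtain ⟨a, ha, c, hc, hac⟩ := Submodule.mem_sup.1 hk
    rw [← Ideal.radical_idem]
    refine ⟨k + 1, ?_⟩
    rw [pow_succ, ← hac, add_mul]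
    exact add_mem (Ideal.mul_mem_right _ _ (Ideal.le_radical (Ideal.mem_sup_left ha))) (h₂ c hc)
  · obtain ⟨T₁, T₂, hT₁, hT₂, hψ₁, hψ₂, hle⟩ :=
      Ideal.exists_lt_mul_le_of_not_isPrime hψ hp hT hTtop hprime
    have h₁ := ih T₁ hT₁ hψ₁ y (Ideal.radical_mono (sup_le_sup_left hT₁.le _) hy)
    have h₂ := ih T₂ hT₂ hψ₂ y (Ideal.radical_mono (sup_le_sup_left hT₂.le _) hy)
    have h : ψ y ∈ ((I.map (algebraMap R S) ⊔ T₁) * (I.map (algebraMap R S) ⊔ T₂)).radical := by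
      rw [Ideal.radical_mul]
      exact ⟨h₁, h₂⟩
    refine Ideal.radical_mono (Ideal.mul_le.2 fun a ha b hb => ?_) h
    obtain ⟨a₁, ha₁, a₂, ha₂, rfl⟩ := Submodule.mem_sup.1 ha
    obtain ⟨b₁, hb₁, b₂, hb₂, rfl⟩ := Submodule.mem_sup.1 hb
    rw [add_mul, mul_add a₂]
    exact add_mem (Ideal.mem_sup_left (Ideal.mul_mem_right _ _ ha₁))
      (add_mem (Ideal.mem_sup_left (Ideal.mul_mem_left _ _ hb₁))
        (Ideal.mem_sup_right (hle (Ideal.mul_mem_mul ha₂ hb₂))))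

end Induction

/-- Main theorem, affine form: Frobenius split subvarieties pull back along finite maps in
all sufficiently large characteristics. Let `A`, `B` be domains finitely generated as
`ℤ`-algebras and `f : A → B` an injective ring homomorphism making `B` a finitely generated
`A`-module. Then there is `N > 0` such that for all primes `p > N`: for any compatible
Frobenius splittings `φ` of `A/pA` and `ψ` of `B/pB` and any radical ideal `I` of `A/pA`
compatibly split by `φ`, the radical of the extension of `I` to `B/pB` is compatibly split
by `ψ`. -/
theorem compatibly_split_pullback (A B : Type) [CommRing A] [CommRing B]
    [IsDomain A] [IsDomain B] [Algebra.FiniteType ℤ A] [Algebra.FiniteType ℤ B]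
    (f : A →+* B) (hinj : Function.Injective f) (hfin : f.Finite) :
    ∃ N : ℕ, 0 < N ∧ ∀ p : ℕ, p.Prime → N < p →
      ∀ φ : A ⧸ Ideal.span {(p : A)} → A ⧸ Ideal.span {(p : A)},
      ∀ ψ : B ⧸ Ideal.span {(p : B)} → B ⧸ Ideal.span {(p : B)},
        (∀ a b, φ (a + b) = φ a + φ b) → (∀ a b, φ (a ^ p * b) = a * φ b) → φ 1 = 1 →
        (∀ a b, ψ (a + b) = ψ a + ψ b) → (∀ a b, ψ (a ^ p * b) = a * ψ b) → ψ 1 = 1 →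
        (∀ a, ψ (reduceModP f p a) = reduceModP f p (φ a)) →
        ∀ I : Ideal (A ⧸ Ideal.span {(p : A)}), I.radical = I → (∀ x ∈ I, φ x ∈ I) →
          ∀ y ∈ (I.map (reduceModP f p)).radical, ψ y ∈ (I.map (reduceModP f p)).radical := by
  algebraize [f]
  obtain ⟨n, g, hg⟩ := Module.Finite.exists_fin (R := A) (M := B)
  refine ⟨n + 1, n.succ_pos, fun p hp hnp φ ψ hφ₁ hφ₂ hφ₃ hψ₁ hψ₂ hψ₃ hφψ I _ hI => ?_⟩
  have : Fact p.Prime := ⟨hp⟩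
  algebraize [reduceModP f p]
  have : IsNoetherianRing B := Algebra.FiniteType.isNoetherianRing ℤ B
  have h := IsFrobeniusSplitting.map_mem_radical_map_sup (p := p) (n := n) ⟨hφ₁, hφ₂, hφ₃⟩
    ⟨hψ₁, hψ₂, hψ₃⟩ hφψ (by
      rw [← map_natCast (Ideal.Quotient.mk (Ideal.span {(p : A)}))]
      exact Ideal.Quotient.eq_zero_iff_mem.2 (Ideal.mem_span_singleton_self _)) (by omega)
    (Ideal.Quotient.mk _ ∘ g)
    (Submodule.span_range_comp_eq_top (Ideal.Quotient.mk _) (Ideal.Quotient.mk _)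
      Ideal.Quotient.mk_surjective (fun _ => rfl) g hg) hI ⊥ (by
      rintro x rfl
      simpa using hψ₁ 0 0)
  rwa [sup_bot_eq] at h
end

section
/- Let p be a prime, let L be a field of characteristic p, and let K be a subfield of L with L finite-dimensional over K. Let φ : L → L be a function satisfying φ(a+b) = φ(a)+φ(b), φ(aᵖ·b) = a·φ(b) for all a, b ∈ L, and φ(1) = 1, and suppose φ(K) ⊆ K. Then for every x ∈ L, Tr_{L/K}(φ(x)) = φ(Tr_{L/K}(x)) (both sides being elements of K, viewed inside L). -/
/-- In characteristic `p`, the trace of a finite separable extension commutes with Frobenius. -/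
theorem Algebra.trace_pow_char_of_isSeparable (p : ℕ) [Fact p.Prime] (K L : Type*) [Field K]
    [Field L] [Algebra K L] [FiniteDimensional K L] [Algebra.IsSeparable K L] [CharP K p] (x : L) :
    Algebra.trace K L (x ^ p) = Algebra.trace K L x ^ p := by
  have : CharP (AlgebraicClosure K) p := charP_of_injective_algebraMap' K p
  apply FaithfulSMul.algebraMap_injective K (AlgebraicClosure K)
  rw [map_pow (algebraMap K _), trace_eq_sum_embeddings, trace_eq_sum_embeddings, sum_pow_char]
  simp

/-- Let `p` be a prime, `L` a field of characteristic `p`, and `K` a subfield of `L`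
with `L` finite-dimensional over `K`. If `φ : L → L` is a Frobenius splitting
(`φ(a+b) = φ(a)+φ(b)`, `φ(a^p * b) = a * φ(b)`, `φ(1) = 1`) with `φ(K) ⊆ K`, then
for every `x ∈ L` we have `Tr_{L/K}(φ(x)) = φ(Tr_{L/K}(x))`, both sides viewed in `L`. -/
theorem trace_comm_splitting (p : ℕ) (hp : p.Prime) (L : Type) [Field L] [CharP L p]
    (K : Subfield L) [FiniteDimensional K L]
    (φ : L → L)
    (hadd : ∀ a b : L, φ (a + b) = φ a + φ b)
    (hmul : ∀ a b : L, φ (a ^ p * b) = a * φ b)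
    (hone : φ 1 = 1)
    (hK : ∀ a : L, a ∈ K → φ a ∈ K) :
    ∀ x : L,
      (algebraMap K L) (Algebra.trace K L (φ x)) =
        φ ((algebraMap K L) (Algebra.trace K L x)) := by
  intro x
  have : Fact p.Prime := ⟨hp⟩
  have : CharP K p := (algebraMap K L).charP (algebraMap K L).injective p
  have hzero : φ 0 = 0 := by simpa using hadd 0 0
  by_cases hsep : Algebra.IsSeparable K L
  · have hspan : x ∈ Submodule.span K (Set.range fun y : L ↦ y ^ p) := by
      have h := Field.span_map_pow_expChar_pow_eq_top_of_isSeparable (F := K) (E := L) p 1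
        (v := (id : L → L)) (by simp)
      simp only [pow_one, id_eq] at h
      rw [h]
      trivial
    induction hspan using Submodule.closure_induction with
    | zero => simp [hzero]
    | add y z _ _ hy hz => simp [hadd, hy, hz]
    | smul_mem a y hy =>
      obtain ⟨b, rfl⟩ := hy
      beta_reduce
      have hφ : φ (a • b ^ p) = (⟨φ a, hK a a.2⟩ : K) • b := by
        rw [Subfield.smul_def, smul_eq_mul, mul_comm, hmul, mul_comm]
        rfl
      rw [hφ, map_smul, map_smul (Algebra.trace K L), Algebra.trace_pow_char_of_isSeparable p]
      simp only [smul_eq_mul, map_mul, map_pow]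
      rw [mul_comm (algebraMap K L a), hmul, mul_comm]
      rfl
  · simp [Algebra.trace_eq_zero_of_not_isSeparable hsep, hzero]
end

section
/- Let A be a domain that is finitely generated as a ℤ-algebra and let Ã be the integral closure of A in its fraction field. Then there exists a positive integer N such that for every prime p > N, the ring Ã/pÃ is reduced and is integrally closed in its total ring of fractions (i.e., in the localization of Ã/pÃ at its set of nonzerodivisors). -/
/-- The `ℤ`-torsion of a Noetherian module is killed by a single positive integer. -/
theorem IsNoetherian.exists_nsmul_eq_zero_of_torsion (B M : Type*) [CommRing B] [AddCommGroup M]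
    [Module B M] [IsNoetherian B M] :
    ∃ N : ℕ, 0 < N ∧ ∀ (x : M) (n : ℕ), n ≠ 0 → n • x = 0 → N • x = 0 := by
  let K : ℕ →o Submodule B M :=
    { toFun := fun n ↦ LinearMap.ker (LinearMap.lsmul B M (n.factorial : B))
      monotone' := by
        intro m n hmn x hx
        obtain ⟨k, hk⟩ := Nat.factorial_dvd_factorial hmn
        simp only [LinearMap.mem_ker, LinearMap.lsmul_apply] at hx ⊢
        rw [hk, Nat.cast_mul, mul_comm, mul_smul, hx, smul_zero] }
  have hK : ∀ n x, x ∈ K n ↔ n.factorial • x = 0 := fun n x ↦ by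
    rw [← Nat.cast_smul_eq_nsmul B]; exact LinearMap.mem_ker
  obtain ⟨n₀, hn₀⟩ := monotone_stabilizes_iff_noetherian.mpr ‹IsNoetherian B M› K
  refine ⟨n₀.factorial, n₀.factorial_pos, fun x n hn hx ↦ (hK _ _).mp ?_⟩
  rw [hn₀ _ (le_max_left n₀ n), hK]
  obtain ⟨k, hk⟩ := Nat.dvd_factorial (Nat.pos_of_ne_zero hn) (le_max_right n₀ n)
  rw [hk, mul_comm, mul_smul, hx, smul_zero]

theorem IsNoetherian.exists_forall_prime_smul_eq_zero (B M : Type*) [CommRing B] [AddCommGroup M]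
    [Module B M] [IsNoetherian B M] :
    ∃ N : ℕ, ∀ p : ℕ, p.Prime → N < p → ∀ x : M, (p : B) • x = 0 → x = 0 := by
  obtain ⟨N, hN, h⟩ := IsNoetherian.exists_nsmul_eq_zero_of_torsion B M
  refine ⟨N, fun p hp hNp x hx ↦ ?_⟩
  rw [Nat.cast_smul_eq_nsmul] at hx
  have hco : Nat.Coprime p N := (Nat.Prime.coprime_iff_not_dvd hp).mpr
    fun hd ↦ (Nat.le_of_dvd hN hd).not_gt hNp
  have h1 : addOrderOf x ∣ Nat.gcd p N :=
    Nat.dvd_gcd (addOrderOf_dvd_of_nsmul_eq_zero hx)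
      (addOrderOf_dvd_of_nsmul_eq_zero (h x p hp.ne_zero hx))
  rw [hco, Nat.dvd_one, AddMonoid.addOrderOf_eq_one_iff] at h1
  exact h1

/-- If `x` is integral over `C` and `j * x = a` with `j` in a radical ideal, then so is `a`. -/
theorem IsIntegral.mem_of_algebraMap_mul_eq {C K : Type*} [CommRing C] [CommRing K] [Algebra C K]
    (hinj : Function.Injective (algebraMap C K)) {J : Ideal C} (hJ : J.IsRadical) {x : K}
    (hx : IsIntegral C x) {j a : C} (hj : j ∈ J)
    (h : algebraMap C K j * x = algebraMap C K a) : a ∈ J := by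
  obtain ⟨q, hq, hq0⟩ := hx
  have h1 := Polynomial.scaleRoots_eval₂_eq_zero (s := j) (algebraMap C K) hq0
  rw [h, Polynomial.eval₂_at_apply, map_eq_zero_iff _ hinj, Polynomial.eval_eq_sum_range,
    Finset.sum_range_succ, Polynomial.natDegree_scaleRoots, Polynomial.coeff_scaleRoots_natDegree,
    hq.leadingCoeff, one_mul] at h1
  refine hJ ⟨q.natDegree, ?_⟩
  rw [eq_neg_of_add_eq_zero_right h1]
  refine J.neg_mem (J.sum_mem fun i hi ↦ J.mul_mem_right _ ?_)
  rw [Polynomial.coeff_scaleRoots]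
  exact J.mul_mem_left _ (J.pow_mem_of_mem hj _ (Nat.sub_pos_of_lt (Finset.mem_range.mp hi)))

/-- The Grauert–Remmert criterion: if `J` is a radical ideal containing `f`, with the same radical
as `(f)`, and multiplication by `C` exhausts the endomorphisms of `J`, then elements of `C[1/f]`
integral over `C` lie in `C`. -/
theorem IsIntegral.exists_algebraMap_eq_of_radical {C K : Type*} [CommRing C] [CommRing K]
    [Algebra C K] (hinj : Function.Injective (algebraMap C K)) {f : C}
    (hf : IsUnit (algebraMap C K f)) {J : Ideal C} (hJ : J.IsRadical) (hfg : J.FG) (hfJ : f ∈ J)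
    (hJf : J ≤ (Ideal.span {f}).radical)
    (hcolon : ∀ c, (∀ j ∈ J, ∃ a ∈ J, c * j = f * a) → f ∣ c)
    {x : K} (hx : IsIntegral C x) (n : ℕ) (hn : ∃ c, algebraMap C K c = algebraMap C K f ^ n * x) :
    ∃ c, algebraMap C K c = x := by
  have hstep : ∀ y : K, IsIntegral C y →
      (∀ j ∈ J, ∃ c, algebraMap C K c = algebraMap C K j * y) → ∃ c, algebraMap C K c = y := by
    intro y hy h
    obtain ⟨c, hc⟩ := h f hfJ
    obtain ⟨d, rfl⟩ := hcolon c fun j hj ↦ by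
      obtain ⟨a, ha⟩ := h j hj
      refine ⟨a, hy.mem_of_algebraMap_mul_eq hinj hJ hj ha.symm, hinj ?_⟩
      rw [map_mul, map_mul, hc, ha]; ring
    exact ⟨d, hf.mul_left_cancel (by rw [← map_mul, hc])⟩
  have hpow : ∀ k : ℕ, ∀ y : K, IsIntegral C y →
      (∀ j ∈ J ^ k, ∃ c, algebraMap C K c = algebraMap C K j * y) →
      ∃ c, algebraMap C K c = y := by
    intro k
    induction k with
    | zero => intro y _ h; simpa using h 1 (by simp)
    | succ k ih =>
      intro y hy h
      refine ih y hy fun g hg ↦ hstep _ (isIntegral_algebraMap.mul hy) fun j hj ↦ ?_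
      obtain ⟨c, hc⟩ := h (g * j) (pow_succ J k ▸ Ideal.mul_mem_mul hg hj)
      exact ⟨c, by rw [hc, map_mul]; ring⟩
  obtain ⟨k, hk⟩ := Ideal.exists_pow_le_of_le_radical_of_fg
    (hJf.trans (Ideal.radical_mono (J := (Ideal.span {f ^ n}).radical)
      (Ideal.span_le.mpr (Set.singleton_subset_iff.mpr
        ⟨n, Ideal.mem_span_singleton_self _⟩))) |>.trans (Ideal.radical_idem _).le) hfg
  obtain ⟨c, hc⟩ := hn
  refine hpow k x hx fun j hj ↦ ?_
  obtain ⟨d, rfl⟩ := Ideal.mem_span_singleton.mp (hk hj)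
  exact ⟨d * c, by rw [map_mul, hc, map_mul, map_pow]; ring⟩

open TensorProduct in
/-- An étale algebra over an integrally closed domain is reduced and integrally closed in its
total ring of fractions. -/
theorem Algebra.Etale.isReduced_and_isIntegrallyClosed (P T : Type) [CommRing P] [IsDomain P]
    [IsIntegrallyClosed P] [CommRing T] [Algebra P T] [Algebra.Etale P T] :
    IsReduced T ∧ IsIntegrallyClosed T := by
  let e : FractionRing P ⊗[P] T ≃+* T ⊗[P] FractionRing P :=
    (Algebra.TensorProduct.comm P (FractionRing P) T).toRingEquiv
  have : Module.Finite (FractionRing P) (FractionRing P ⊗[P] T) :=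
    Algebra.FormallyUnramified.finite_of_free _ _
  have : IsArtinianRing (FractionRing P ⊗[P] T) := .of_finite (FractionRing P) _
  have : IsArtinianRing (T ⊗[P] FractionRing P) := e.isArtinianRing
  have : IsReduced (FractionRing P ⊗[P] T) :=
    Algebra.FormallyUnramified.isReduced_of_field (FractionRing P) _
  have hinj : Function.Injective (algebraMap T (T ⊗[P] FractionRing P)) :=
    Algebra.TensorProduct.includeLeft_injective (S := P) (IsFractionRing.injective _ _)
  have hloc : IsLocalization (Algebra.algebraMapSubmonoid T (nonZeroDivisors P))
      (T ⊗[P] FractionRing P) := inferInstance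
  have hle : Algebra.algebraMapSubmonoid T (nonZeroDivisors P) ≤ nonZeroDivisors T := by
    intro m hm
    rw [mem_nonZeroDivisors_iff_right]
    intro z hz
    apply hinj
    have hu := IsLocalization.map_units (T ⊗[P] FractionRing P) ⟨m, hm⟩
    exact hu.mul_right_cancel (by rw [← map_mul, hz]; simp)
  have hfr : IsFractionRing T (T ⊗[P] FractionRing P) := by
    refine IsLocalization.isLocalization_of_is_exists_mul_mem _ _ _ hle fun x ↦ ?_
    have hx : IsUnit (algebraMap T (T ⊗[P] FractionRing P) x) :=
      IsArtinianRing.isUnit_of_mem_nonZeroDivisors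
        (IsLocalization.map_nonZeroDivisors_le (Algebra.algebraMapSubmonoid T (nonZeroDivisors P))
          _ ⟨x, x.2, rfl⟩)
    obtain ⟨y, hy⟩ := hx.exists_left_inv
    obtain ⟨⟨t, s⟩, hts⟩ :=
      IsLocalization.surj (Algebra.algebraMapSubmonoid T (nonZeroDivisors P)) y
    refine ⟨t, ?_⟩
    convert s.2
    apply hinj
    rw [map_mul, ← hts, mul_right_comm, hy, one_mul]
  constructor
  · refine @isReduced_of_injective _ _ _ _ _ _ _ (e.symm.toRingHom.comp (algebraMap T _))
      (e.symm.injective.comp hinj) this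
  · rw [isIntegrallyClosed_iff (T ⊗[P] FractionRing P)]
    intro x hx
    obtain ⟨y, hy⟩ := (TensorProduct.toIntegralClosure_bijective_of_smooth
      (R := P) (S := T) (B := FractionRing P)).2 ⟨x, hx⟩
    obtain rfl : (TensorProduct.toIntegralClosure P T (FractionRing P) y).1 = x := by rw [hy]
    clear hy hx
    induction y with
    | zero => exact ⟨0, by simp⟩
    | add y z hy hz =>
      obtain ⟨a, ha⟩ := hy
      obtain ⟨b, hb⟩ := hz
      exact ⟨a + b, by rw [map_add, ha, hb, map_add]; rfl⟩
    | tmul t b =>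
      obtain ⟨c, hc⟩ := IsIntegrallyClosed.isIntegral_iff.mp b.2
      refine ⟨c • t, ?_⟩
      change (c • t) ⊗ₜ[P] (1 : FractionRing P) = t ⊗ₜ[P] (b : FractionRing P)
      rw [TensorProduct.smul_tmul, ← hc, Algebra.algebraMap_eq_smul_one]

/-- A domain of characteristic zero of finite type over `ℤ` is generically étale over a polynomial
ring over `ℤ`. -/
theorem Algebra.exists_etale_localizationAway_of_charZero (F : Type) [CommRing F] [IsDomain F]
    [CharZero F] [Algebra.FiniteType ℤ F] :
    ∃ f : F, f ≠ 0 ∧ ∃ (σ : Type) (_ : Algebra (MvPolynomial σ ℤ) F),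
      Algebra.Etale (MvPolynomial σ ℤ) (Localization.Away f) := by
  obtain ⟨s, hs⟩ := ‹Algebra.FiniteType ℤ F›
  have halg : Algebra.IsAlgebraic (Algebra.adjoin ℤ (s : Set F)) F :=
    ⟨fun x ↦ isAlgebraic_algebraMap (⟨x, hs ▸ Algebra.mem_top⟩ : Algebra.adjoin ℤ (s : Set F))⟩
  have : FaithfulSMul ℤ F := (faithfulSMul_iff_algebraMap_injective ℤ F).mpr
    (RingHom.injective_int _)
  obtain ⟨t, hts, ht⟩ := exists_isTranscendenceBasis_subset (R := ℤ) (s : Set F)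
  have : Finite t := s.finite_toSet.subset hts
  let R := MvPolynomial t ℤ
  let φ : R →ₐ[ℤ] F := MvPolynomial.aeval ((↑) : t → F)
  let _ : Algebra R F := φ.toRingHom.toAlgebra
  have hφ : Function.Injective (algebraMap R F) := ht.1
  have : FaithfulSMul R F := (faithfulSMul_iff_algebraMap_injective R F).mpr hφ
  have : Algebra.IsAlgebraic R F := by
    have h := ht.isAlgebraic
    refine Algebra.IsAlgebraic.of_ringHom_of_comp_eq (R := R) (A := F)
      (S := Algebra.adjoin ℤ (Set.range ((↑) : t → F))) (B := F)
      ht.1.aevalEquiv (RingHom.id F) ht.1.aevalEquiv.surjective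
      Function.injective_id ?_
    exact RingHom.ext fun x ↦ ht.1.aevalEquiv_apply_coe x
  have : Algebra.FiniteType R F := .of_restrictScalars_finiteType ℤ R F
  have : Algebra.FinitePresentation R F := Algebra.FinitePresentation.of_finiteType.mp this
  let L := Localization.AtPrime (⊥ : Ideal F)
  have hL : IsFractionRing F L := by
    have : (⊥ : Ideal F).primeCompl = nonZeroDivisors F := by ext; simp [Ideal.primeCompl]
    exact IsLocalization.of_le_of_exists_dvd (⊥ : Ideal F).primeCompl _ this.le
      fun x hx ↦ ⟨x, this ▸ hx, dvd_rfl⟩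
  let _ : Field L := IsFractionRing.toField F
  have : FaithfulSMul R L := .trans R F L
  let K := FractionRing R
  let _ : Algebra K L := FractionRing.liftAlgebra R L
  have : CharZero L := charZero_of_injective_algebraMap (IsFractionRing.injective F L)
  have : Algebra.IsAlgebraic R L := (IsFractionRing.isAlgebraic_iff' R F L).mp inferInstance
  have : Algebra.IsAlgebraic K L := IsFractionRing.comap_isAlgebraic_iff.mp this
  have : Algebra.FormallyEtale R K := .of_isLocalization (nonZeroDivisors R)
  have : Algebra.FormallyEtale K L := .of_isSeparable K L
  have : Algebra.IsEtaleAt R (⊥ : Ideal F) := Algebra.FormallyEtale.comp R K L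
  obtain ⟨f, hf, h⟩ := Algebra.exists_etale_of_isEtaleAt (R := R) (⊥ : Ideal F)
  exact ⟨f, hf, t, _, h⟩

theorem MvPolynomial.isIntegrallyClosed_quotient_natCast (σ : Type) (p : ℕ) (hp : p.Prime) :
    IsDomain (MvPolynomial σ ℤ ⧸ Ideal.span {(p : MvPolynomial σ ℤ)}) ∧
      IsIntegrallyClosed (MvPolynomial σ ℤ ⧸ Ideal.span {(p : MvPolynomial σ ℤ)}) := by
  have : Fact p.Prime := ⟨hp⟩
  have hI : (Ideal.span {(p : ℤ)}).map (MvPolynomial.C : ℤ →+* MvPolynomial σ ℤ) =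
      Ideal.span {(p : MvPolynomial σ ℤ)} := by simp [Ideal.map_span]
  let e : MvPolynomial σ (ZMod p) ≃+* MvPolynomial σ ℤ ⧸ Ideal.span {(p : MvPolynomial σ ℤ)} :=
    ((MvPolynomial.mapEquiv σ (Int.quotientSpanNatEquivZMod p).symm).trans
      (MvPolynomial.quotientEquivQuotientMvPolynomial (σ := σ)
        (Ideal.span {(p : ℤ)})).toRingEquiv).trans (Ideal.quotEquivOfEq hI)
  exact ⟨e.symm.toMulEquiv.isDomain _, .of_equiv e⟩

theorem Algebra.Etale.isReduced_and_isIntegrallyClosed_quotient_natCast (σ G : Type) [CommRing G]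
    [Algebra (MvPolynomial σ ℤ) G] [Algebra.Etale (MvPolynomial σ ℤ) G] (p : ℕ) (hp : p.Prime) :
    IsReduced (G ⧸ Ideal.span {(p : G)}) ∧ IsIntegrallyClosed (G ⧸ Ideal.span {(p : G)}) := by
  obtain ⟨_, _⟩ := MvPolynomial.isIntegrallyClosed_quotient_natCast σ p hp
  let R := MvPolynomial σ ℤ
  let I := Ideal.span {(p : R)}
  have hI : I.map (algebraMap R G) = Ideal.span {(p : G)} := by simp [Ideal.map_span, I]
  obtain ⟨_, _⟩ := Algebra.Etale.isReduced_and_isIntegrallyClosed (R ⧸ I)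
    (TensorProduct R (R ⧸ I) G)
  let e : TensorProduct R (R ⧸ I) G ≃+* G ⧸ Ideal.span {(p : G)} :=
    ((Algebra.TensorProduct.comm R (R ⧸ I) G).toRingEquiv.trans
      (Algebra.TensorProduct.quotIdealMapEquivTensorQuot G I).symm.toRingEquiv).trans
      (Ideal.quotEquivOfEq hI)
  exact ⟨isReduced_of_injective e.symm e.symm.injective,
    IsIntegrallyClosed.of_equiv (R := TensorProduct R (R ⧸ I) G) e⟩

theorem Algebra.exists_isReduced_and_isIntegrallyClosed_localizationAway (F : Type) [CommRing F]
    [IsDomain F] [CharZero F] [Algebra.FiniteType ℤ F] :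
    ∃ f : F, f ≠ 0 ∧ ∀ p : ℕ, p.Prime →
      IsReduced (Localization.Away f ⧸ Ideal.span {(p : Localization.Away f)}) ∧
      IsIntegrallyClosed (Localization.Away f ⧸ Ideal.span {(p : Localization.Away f)}) := by
  obtain ⟨f, hf, σ, _, _⟩ := exists_etale_localizationAway_of_charZero F
  exact ⟨f, hf, fun p hp ↦
    Algebra.Etale.isReduced_and_isIntegrallyClosed_quotient_natCast σ _ p hp⟩

theorem IsNoetherianRing.exists_forall_prime_dvd_of_dvd_mul (B : Type*) [CommRing B] [IsDomain B]
    [IsNoetherianRing B] {f : B} (hf : f ≠ 0) :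
    ∃ N : ℕ, ∀ p : ℕ, p.Prime → N < p → ∀ x : B, (p : B) ∣ f * x → (p : B) ∣ x := by
  obtain ⟨N, hN⟩ := IsNoetherian.exists_forall_prime_smul_eq_zero B (B ⧸ Ideal.span {f})
  refine ⟨N, fun p hp hpN x ⟨y, hy⟩ ↦ ?_⟩
  have h := hN p hp hpN (Ideal.Quotient.mk _ y) (by
    rw [Algebra.smul_def, Ideal.Quotient.algebraMap_eq, ← map_mul, Ideal.Quotient.eq_zero_iff_mem,
      Ideal.mem_span_singleton, ← hy]
    exact dvd_mul_right ..)
  rw [Ideal.Quotient.eq_zero_iff_mem, Ideal.mem_span_singleton] at h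
  obtain ⟨z, rfl⟩ := h
  exact ⟨z, mul_left_cancel₀ hf (by rw [hy]; ring)⟩

theorem IsLocalization.Away.exists_dvd_pow_mul {B : Type*} [CommRing B] [IsDomain B] {f : B}
    (hf : f ≠ 0) (G : Type*) [CommRing G] [Algebra B G] [IsLocalization.Away f G] {a x : B}
    (h : algebraMap B G a ∣ algebraMap B G x) : ∃ n : ℕ, a ∣ f ^ n * x := by
  obtain ⟨g, hg⟩ := h
  obtain ⟨n, b, hb⟩ := IsLocalization.Away.surj f g
  have hinj : Function.Injective (algebraMap B G) := IsLocalization.injective G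
    (Submonoid.powers_le.mpr (mem_nonZeroDivisors_of_ne_zero hf))
  exact ⟨n, b, hinj (by rw [map_mul, map_mul, map_pow, hg, ← hb]; ring)⟩

theorem Nat.Prime.isUnit_cast_of_charP {p ℓ : ℕ} (hp : p.Prime) (h0 : ℓ ≠ 0) (h : ℓ < p)
    (E : Type*) [CommRing E] [CharP E ℓ] : IsUnit (p : E) := by
  have : IsCoprime (p : ℤ) ℓ := Nat.isCoprime_iff_coprime.mpr
    (hp.coprime_iff_not_dvd.mpr fun hd ↦ (Nat.le_of_dvd (by lia) hd).not_gt h)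
  have := this.map (Int.castRingHom E)
  simpa [isCoprime_zero_right] using this

/-- A domain of finite type over `ℤ` has reduced reduction modulo almost all primes. -/
theorem IsDomain.exists_forall_prime_isRadical_span_natCast (E : Type) [CommRing E]
    [Algebra.FiniteType ℤ E] [IsDomain E] :
    ∃ N : ℕ, ∀ p : ℕ, p.Prime → N < p → (Ideal.span {(p : E)}).IsRadical := by
  obtain ⟨ℓ, hℓ⟩ := CharP.exists E
  have : IsNoetherianRing E := Algebra.FiniteType.isNoetherianRing ℤ E
  by_cases h0 : ℓ = 0
  · subst h0
    have : CharZero E := CharP.charP_to_charZero E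
    obtain ⟨f, hf, h⟩ := Algebra.exists_isReduced_and_isIntegrallyClosed_localizationAway E
    obtain ⟨N, hN⟩ := IsNoetherianRing.exists_forall_prime_dvd_of_dvd_mul E hf
    refine ⟨N, fun p hp hpN x ⟨n, hx⟩ ↦ ?_⟩
    have hr := (Ideal.isRadical_iff_quotient_reduced _).mpr (h p hp).1
    have hx' : algebraMap E (Localization.Away f) x ∈
        Ideal.span {(p : Localization.Away f)} := by
      refine hr ⟨n, ?_⟩
      rw [Ideal.mem_span_singleton] at hx ⊢
      simpa using map_dvd (algebraMap E (Localization.Away f)) hx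
    rw [Ideal.mem_span_singleton, ← map_natCast (algebraMap E (Localization.Away f))] at hx'
    obtain ⟨k, hk⟩ := IsLocalization.Away.exists_dvd_pow_mul hf _ hx'
    rw [Ideal.mem_span_singleton]
    clear hx
    induction k with
    | zero => simpa using hk
    | succ k ih => exact ih (hN p hp hpN _ (by rwa [← mul_assoc, ← pow_succ']))
  · refine ⟨ℓ, fun p hp hpN ↦ ?_⟩
    rw [Ideal.span_singleton_eq_top.mpr (hp.isUnit_cast_of_charP h0 hpN E)]
    exact fun _ _ ↦ trivial

theorem Algebra.FiniteType.int_of_surjective {E Q : Type*} [CommRing E] [CommRing Q]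
    [Algebra.FiniteType ℤ E] (f : E →+* Q) (hf : Function.Surjective f) :
    Algebra.FiniteType ℤ Q :=
  .of_surjective f.toIntAlgHom hf

theorem IsReduced.exists_forall_prime_isRadical_span_natCast (E : Type) [CommRing E]
    [Algebra.FiniteType ℤ E] [IsReduced E] :
    ∃ N : ℕ, ∀ p : ℕ, p.Prime → N < p → (Ideal.span {(p : E)}).IsRadical := by
  have : IsNoetherianRing E := Algebra.FiniteType.isNoetherianRing ℤ E
  have : Finite (minimalPrimes E) := (minimalPrimes.finite_of_isNoetherianRing E).to_subtype
  have hprime (P : minimalPrimes E) : P.1.IsPrime := P.2.1.1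
  have (P : Ideal E) := Algebra.FiniteType.int_of_surjective (Ideal.Quotient.mk P)
    Ideal.Quotient.mk_surjective
  choose N hN using fun P : minimalPrimes E ↦
    IsDomain.exists_forall_prime_isRadical_span_natCast (E ⧸ P.1)
  let φ : E →ₗ[E] (∀ P : minimalPrimes E, E ⧸ P.1) := LinearMap.pi fun P ↦ P.1.mkQ
  have hφ : Function.Injective φ := by
    rw [injective_iff_map_eq_zero]
    intro x hx
    have : x ∈ sInf (minimalPrimes E) := by
      rw [Ideal.mem_sInf]
      intro P hP
      exact (Submodule.Quotient.mk_eq_zero _).mp (congrFun hx ⟨P, hP⟩)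
    rw [minimalPrimes, Ideal.sInf_minimalPrimes] at this
    exact IsNilpotent.eq_zero (mem_nilradical.mp this)
  obtain ⟨M, hM⟩ := IsNoetherian.exists_forall_prime_smul_eq_zero E
    ((∀ P : minimalPrimes E, E ⧸ P.1) ⧸ LinearMap.range φ)
  obtain ⟨N', hN'⟩ := Set.finite_range N |>.bddAbove
  refine ⟨max N' M, fun p hp hpN x ⟨n, hx⟩ ↦ ?_⟩
  have h (P : minimalPrimes E) : ∃ y, φ x P = p * y := by
    have : φ x P ∈ Ideal.span {(p : E ⧸ P.1)} := by
      refine hN P p hp (lt_of_le_of_lt (hN' ⟨P, rfl⟩) (by lia)) ⟨n, ?_⟩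
      rw [Ideal.mem_span_singleton] at hx ⊢
      simpa using! map_dvd (Ideal.Quotient.mk P.1) hx
    exact Ideal.mem_span_singleton.mp this
  choose y hy using h
  have hy' : φ x = (p : E) • y := by
    ext P
    simp [hy, Algebra.smul_def]
  have hz := hM p hp (by lia) (Submodule.Quotient.mk y) (by
    rw [← Submodule.Quotient.mk_smul, ← hy', Submodule.Quotient.mk_eq_zero]
    exact ⟨x, rfl⟩)
  rw [Submodule.Quotient.mk_eq_zero] at hz
  obtain ⟨z, rfl⟩ := hz
  rw [← map_smul] at hy'
  rw [hφ hy']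
  exact Ideal.mul_mem_right _ _ (Ideal.mem_span_singleton_self _)

theorem IsLocalization.Away.exists_algebraMap_eq_pow_mul_of_isIntegral {C T K : Type*}
    [CommRing C] [CommRing T] [CommRing K] [Algebra C T] [Algebra C K] [IsFractionRing C K]
    {f : C} (hf : f ∈ nonZeroDivisors C) [IsLocalization.Away f T] [IsIntegrallyClosed T]
    {x : K} (hx : IsIntegral C x) : ∃ n c, algebraMap C K c = algebraMap C K f ^ n * x := by
  have hle : Submonoid.powers f ≤ nonZeroDivisors C := Submonoid.powers_le.mpr hf
  let g : T →+* K := IsLocalization.lift (M := Submonoid.powers f) (g := algebraMap C K)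
    fun y ↦ IsLocalization.map_units K ⟨y.1, hle y.2⟩
  let _ : Algebra T K := g.toAlgebra
  have : IsScalarTower C T K := .of_algebraMap_eq fun c ↦ (IsLocalization.lift_eq _ c).symm
  have : IsFractionRing T K :=
    IsFractionRing.isFractionRing_of_isLocalization (Submonoid.powers f) T K hle
  obtain ⟨t, rfl⟩ := (IsIntegrallyClosed.isIntegral_iff (R := T)).mp (hx.tower_top (A := T))
  obtain ⟨n, c, hc⟩ := IsLocalization.Away.surj f t
  refine ⟨n, c, ?_⟩
  rw [IsScalarTower.algebraMap_apply C T K, ← hc, map_mul, map_pow,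
    ← IsScalarTower.algebraMap_apply, mul_comm]

theorem IsNoetherianRing.exists_forall_prime_mem_of_colon (B : Type*) [CommRing B]
    [IsNoetherianRing B] (f : B) (J : Ideal B)
    (H : ∀ c, (∀ j ∈ J, ∃ a ∈ J, c * j = f * a) → ∃ n : ℕ, n ≠ 0 ∧ f ∣ n * c) :
    ∃ N : ℕ, ∀ p : ℕ, p.Prime → N < p → ∀ c, (∀ j ∈ J, ∃ a ∈ J, (p : B) ∣ c * j - f * a) →
      ∃ d, (p : B) ∣ c - f * d := by
  obtain ⟨s, hs⟩ := IsNoetherian.noetherian J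
  let Q := B ⧸ (Ideal.span {f} * J)
  let φ : B →ₗ[B] (s → Q) := LinearMap.pi fun j ↦
    (Submodule.mkQ _).comp (LinearMap.mulRight B j.1)
  obtain ⟨N, hN⟩ := IsNoetherian.exists_forall_prime_smul_eq_zero B
    ((s → Q) ⧸ LinearMap.range φ)
  obtain ⟨N₀, hN₀, htors⟩ := IsNoetherian.exists_nsmul_eq_zero_of_torsion B
    (B ⧸ Ideal.span {f})
  refine ⟨max N N₀, fun p hp hpN c hc ↦ ?_⟩
  have hsJ (j : s) : j.1 ∈ J := hs ▸ Submodule.subset_span j.2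
  choose a ha b hb using fun j : s ↦ hc j (hsJ j)
  have hφ : φ c = (p : B) • (fun j ↦ Submodule.Quotient.mk (b j) : s → Q) := by
    ext j
    refine (Submodule.Quotient.eq _).mpr ?_
    refine Ideal.mem_span_singleton_mul.mpr ⟨a j, ha j, ?_⟩
    simp only [LinearMap.mulRight_apply, smul_eq_mul, ← hb]
    ring
  have h0 := hN p hp (by lia) (Submodule.Quotient.mk fun j ↦ Submodule.Quotient.mk (b j)) (by
    rw [← Submodule.Quotient.mk_smul, ← hφ, Submodule.Quotient.mk_eq_zero]
    exact ⟨c, rfl⟩)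
  rw [Submodule.Quotient.mk_eq_zero] at h0
  obtain ⟨b₀, hb₀⟩ := h0
  rw [← hb₀, ← map_smul, ← sub_eq_zero, ← map_sub] at hφ
  have hcol (j) (hj : j ∈ J) : (c - p * b₀) * j ∈ Ideal.span {f} * J := by
    rw [← hs] at hj
    induction hj using Submodule.span_induction with
    | mem j hj => exact (Submodule.Quotient.mk_eq_zero _).mp (congrFun hφ ⟨j, hj⟩)
    | zero => simp
    | add x y _ _ hx hy => rw [mul_add]; exact add_mem hx hy
    | smul r x _ hx => rw [mul_smul_comm]; exact Submodule.smul_mem _ r hx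
  obtain ⟨n, hn, hdvd⟩ := H (c - p * b₀) fun j hj ↦ by
    obtain ⟨a, ha, h⟩ := Ideal.mem_span_singleton_mul.mp (hcol j hj)
    exact ⟨a, ha, h.symm⟩
  have h1 := htors (Submodule.Quotient.mk (c - p * b₀)) n hn (by
    rw [← Submodule.Quotient.mk_smul, Submodule.Quotient.mk_eq_zero, Ideal.mem_span_singleton]
    simpa using hdvd)
  rw [← Submodule.Quotient.mk_smul, Submodule.Quotient.mk_eq_zero, Ideal.mem_span_singleton,
    nsmul_eq_mul] at h1
  obtain ⟨d, hd⟩ := h1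
  have hcop : IsCoprime (N₀ : ℤ) p := Nat.isCoprime_iff_coprime.mpr
    (hp.coprime_iff_not_dvd.mpr fun hd ↦ (Nat.le_of_dvd hN₀ hd).not_gt (by lia)).symm
  obtain ⟨u, v, huv⟩ := hcop.map (Int.castRingHom B)
  simp only [map_natCast] at huv
  exact ⟨u * d, b₀ + v * (c - p * b₀), by linear_combination u * hd - (c - p * b₀) * huv⟩

theorem Ideal.exists_forall_prime_isRadical_map_quotient_natCast (B : Type) [CommRing B]
    [Algebra.FiniteType ℤ B] {J : Ideal B} (hJ : J.IsRadical) :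
    ∃ N : ℕ, ∀ p : ℕ, p.Prime → N < p →
      (J.map (Ideal.Quotient.mk (Ideal.span {(p : B)}))).IsRadical := by
  have := Algebra.FiniteType.int_of_surjective (Ideal.Quotient.mk J) Ideal.Quotient.mk_surjective
  have := J.isRadical_iff_quotient_reduced.mp hJ
  obtain ⟨N, hN⟩ := IsReduced.exists_forall_prime_isRadical_span_natCast (B ⧸ J)
  refine ⟨N, fun p hp hpN x ⟨n, hx⟩ ↦ ?_⟩
  obtain ⟨x, rfl⟩ := Ideal.Quotient.mk_surjective x
  rw [← map_pow, Ideal.mem_map_iff_of_surjective _ Ideal.Quotient.mk_surjective] at hx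
  obtain ⟨y, hy, hxy⟩ := hx
  rw [Ideal.Quotient.eq, Ideal.mem_span_singleton] at hxy
  have h := hN p hp hpN (x := Ideal.Quotient.mk J x) ⟨n, by
    rw [Ideal.mem_span_singleton, ← dvd_neg]
    simpa [Ideal.Quotient.eq_zero_iff_mem.mpr hy] using map_dvd (Ideal.Quotient.mk J) hxy⟩
  obtain ⟨e, he⟩ := Ideal.mem_span_singleton.mp h
  obtain ⟨e, rfl⟩ := Ideal.Quotient.mk_surjective e
  rw [← map_natCast (Ideal.Quotient.mk J), ← map_mul, Ideal.Quotient.eq] at he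
  rw [Ideal.mem_map_iff_of_surjective _ Ideal.Quotient.mk_surjective]
  refine ⟨_, he, ?_⟩
  rw [Ideal.Quotient.eq, Ideal.mem_span_singleton, ← dvd_neg]
  simp

/-- If the normalization of `B` is `B` up to `ℤ`-torsion, then `B / p` is normal
for almost all primes `p`. -/
theorem Algebra.FiniteType.exists_forall_prime_isIntegrallyClosed_quotient (B : Type) [CommRing B]
    [IsDomain B] [CharZero B] [Algebra.FiniteType ℤ B]
    (H : ∀ x : FractionRing B, IsIntegral B x →
      ∃ n : ℕ, n ≠ 0 ∧ ∃ b, algebraMap B (FractionRing B) b = n * x) :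
    ∃ N : ℕ, ∀ p : ℕ, p.Prime → N < p →
      IsReduced (B ⧸ Ideal.span {(p : B)}) ∧ IsIntegrallyClosed (B ⧸ Ideal.span {(p : B)}) := by
  have : IsNoetherianRing B := Algebra.FiniteType.isNoetherianRing ℤ B
  obtain ⟨f, hf, h⟩ := Algebra.exists_isReduced_and_isIntegrallyClosed_localizationAway B
  let J := (Ideal.span {f}).radical
  have hfJ : f ∈ J := Ideal.le_radical (Ideal.mem_span_singleton_self f)
  have hinj : Function.Injective (algebraMap B (FractionRing B)) := IsFractionRing.injective _ _
  obtain ⟨N₁, hN₁⟩ := IsDomain.exists_forall_prime_isRadical_span_natCast B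
  obtain ⟨N₂, hN₂⟩ := IsNoetherianRing.exists_forall_prime_dvd_of_dvd_mul B hf
  obtain ⟨N₃, hN₃⟩ := Ideal.exists_forall_prime_isRadical_map_quotient_natCast B
    (Ideal.radical_isRadical (Ideal.span {f}))
  obtain ⟨N₄, hN₄⟩ := IsNoetherianRing.exists_forall_prime_mem_of_colon B f J (by
    intro c hc
    have hf' : algebraMap B (FractionRing B) f ≠ 0 := by simpa using hf
    obtain ⟨n, hn, b, hb⟩ := H (algebraMap B _ c / algebraMap B _ f) (by
      refine isIntegral_of_smul_mem_submodule (A := FractionRing B)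
        (Submodule.map (Algebra.linearMap B (FractionRing B)) J) ?_ ?_ _ ?_
      · exact Submodule.ne_bot_iff _ |>.mpr ⟨_, ⟨f, hfJ, rfl⟩, hf'⟩
      · exact (IsNoetherian.noetherian J).map _
      · rintro _ ⟨j, hj, rfl⟩
        obtain ⟨a, ha, h⟩ := hc j hj
        refine ⟨a, ha, ?_⟩
        have := congrArg (algebraMap B (FractionRing B)) h
        rw [map_mul, map_mul] at this
        simp only [Algebra.linearMap_apply, smul_eq_mul]
        field_simp
        rw [this, mul_comm])
    refine ⟨n, hn, b, hinj ?_⟩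
    rw [map_mul, map_mul, hb, map_natCast]
    field_simp)
  refine ⟨max (max N₁ N₂) (max N₃ N₄), fun p hp hpN ↦
    ⟨(Ideal.isRadical_iff_quotient_reduced _).mp (hN₁ p hp (by lia)), ?_⟩⟩
  let I := Ideal.span {(p : B)}
  let C := B ⧸ I
  let G := Localization.Away f
  have hI : I.map (algebraMap B G) = Ideal.span {(p : G)} := by simp [I, Ideal.map_span]
  obtain ⟨-, hT⟩ := h p hp
  rw [← hI] at hT
  let T := G ⧸ I.map (algebraMap B G)
  have hmk : Function.Surjective (Ideal.Quotient.mk I) := Ideal.Quotient.mk_surjective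
  have hmk0 (x : B) : Ideal.Quotient.mk I x = 0 ↔ (p : B) ∣ x := by
    rw [Ideal.Quotient.eq_zero_iff_mem, Ideal.mem_span_singleton]
  have hfC : Ideal.Quotient.mk I f ∈ nonZeroDivisors C := by
    rw [mem_nonZeroDivisors_iff_right]
    intro x hx
    obtain ⟨x, rfl⟩ := hmk x
    rw [← map_mul, hmk0, mul_comm] at hx
    exact (hmk0 x).mpr (hN₂ p hp (by lia) x hx)
  have hloc : IsLocalization.Away (Ideal.Quotient.mk I f) T := by
    have : IsLocalization (Algebra.algebraMapSubmonoid (B ⧸ I) (Submonoid.powers f)) T :=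
      inferInstance
    rwa [Algebra.algebraMapSubmonoid_powers] at this
  refine (isIntegrallyClosed_iff (FractionRing C)).mpr fun {x} hx ↦ ?_
  obtain ⟨n, hn⟩ :=
    IsLocalization.Away.exists_algebraMap_eq_pow_mul_of_isIntegral (T := T) hfC hx
  refine IsIntegral.exists_algebraMap_eq_of_radical (IsFractionRing.injective C _)
    (IsLocalization.map_units (FractionRing C) ⟨_, hfC⟩) (hN₃ p hp (by lia))
    (Ideal.FG.map (IsNoetherian.noetherian J) _) (Ideal.mem_map_of_mem _ hfJ) ?_ ?_ hx n hn
  · exact (Ideal.map_radical_le _).trans_eq (by rw [Ideal.map_span, Set.image_singleton])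
  · intro c hc
    obtain ⟨c, rfl⟩ := hmk c
    obtain ⟨d, hd⟩ := hN₄ p hp (by lia) c fun j hj ↦ by
      obtain ⟨a, ha, h⟩ := hc _ (Ideal.mem_map_of_mem _ hj)
      obtain ⟨a, ha', rfl⟩ := (Ideal.mem_map_iff_of_surjective _ hmk).mp ha
      exact ⟨a, ha', (hmk0 _).mp (by rw [map_sub, map_mul, map_mul, h, sub_self])⟩
    exact ⟨Ideal.Quotient.mk I d, by rw [← sub_eq_zero, ← map_mul, ← map_sub, hmk0]; exact hd⟩

theorem IsIntegralClosure.exists_finset_subset_span (P R L : Type*) [CommRing P] [IsDomain P]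
    [IsIntegrallyClosed P] [IsNoetherianRing P] [CharZero P] [CommRing R] [IsDomain R]
    [Algebra P R] [FaithfulSMul P R] [Module.Finite P R] [Field L] [Algebra R L]
    [IsFractionRing R L] :
    ∃ S : Finset L, (∀ s ∈ S, IsIntegral R s) ∧
      ∀ x : L, IsIntegral R x → x ∈ Submodule.span R (S : Set L) := by
  let _ : Algebra P L := ((algebraMap R L).comp (algebraMap P R)).toAlgebra
  have : IsScalarTower P R L := .of_algebraMap_eq' rfl
  have : FaithfulSMul P L := .trans P R L
  let K := FractionRing P
  let _ : Algebra K L := FractionRing.liftAlgebra P L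
  have : FiniteDimensional K L := .of_isLocalization P R (nonZeroDivisors P)
  have : Module.Finite P (integralClosure P L) := IsIntegralClosure.finite P K L _
  obtain ⟨S, hS⟩ := (Submodule.fg_top (integralClosure P L).toSubmodule).mp this.fg_top
  have hmem (x : L) : x ∈ Submodule.span P (S : Set L) ↔ IsIntegral P x := by rw [hS]; rfl
  refine ⟨S, fun s hs ↦ ((hmem s).mp (Submodule.subset_span hs)).tower_top, fun x hx ↦ ?_⟩
  exact Submodule.span_le_restrictScalars P R _ ((hmem x).mpr (isIntegral_trans x hx))

/-- Up to `ℤ`-torsion, the normalization of a domain of finite type over `ℤ` of characteristic zero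
is generated by finitely many elements. -/
theorem Algebra.FiniteType.exists_finset_adjoin_integralClosure (A L : Type*) [CommRing A]
    [IsDomain A] [CharZero A] [Algebra.FiniteType ℤ A] [Field L] [Algebra A L]
    [IsFractionRing A L] :
    ∃ S : Finset L, (∀ s ∈ S, IsIntegral A s) ∧ ∀ x : L, IsIntegral A x →
      ∃ n : ℤ, n ≠ 0 ∧ n * x ∈ Algebra.adjoin A (S : Set L) := by
  let M := Algebra.algebraMapSubmonoid A (nonZeroDivisors ℤ)
  have hMle : M ≤ nonZeroDivisors A := by
    rintro _ ⟨n, hn, rfl⟩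
    exact mem_nonZeroDivisors_of_ne_zero (by simpa using nonZeroDivisors.ne_zero hn)
  let R := TensorProduct ℤ ℚ A
  let _ : Algebra A R := Algebra.TensorProduct.rightAlgebra
  have : IsLocalization M R := inferInstance
  have : IsDomain R := IsLocalization.isDomain_of_le_nonZeroDivisors R hMle
  let g : R →+* L := IsLocalization.lift (M := M) (g := algebraMap A L)
    fun y ↦ IsLocalization.map_units L ⟨y.1, hMle y.2⟩
  let _ : Algebra R L := g.toAlgebra
  have : IsScalarTower A R L := .of_algebraMap_eq fun c ↦ (IsLocalization.lift_eq _ c).symm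
  have : IsFractionRing R L := IsFractionRing.isFractionRing_of_isDomain_of_isLocalization M R L
  obtain ⟨s, φ, hφ, hfin⟩ := exists_finite_inj_algHom_of_fg ℚ R
  let _ : Algebra (MvPolynomial (Fin s) ℚ) R := φ.toRingHom.toAlgebra
  have : Module.Finite (MvPolynomial (Fin s) ℚ) R := hfin
  have : FaithfulSMul (MvPolynomial (Fin s) ℚ) R :=
    (faithfulSMul_iff_algebraMap_injective _ _).mpr hφ
  obtain ⟨S, hS, hspan⟩ :=
    IsIntegralClosure.exists_finset_subset_span (MvPolynomial (Fin s) ℚ) R L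
  have hmul (x : L) (hx : IsIntegral R x) : ∃ n : ℤ, n ≠ 0 ∧ IsIntegral A (n * x) := by
    obtain ⟨⟨_, n, hn, rfl⟩, h⟩ := hx.exists_multiple_integral_of_isLocalization M x
    exact ⟨n, nonZeroDivisors.ne_zero hn, by simpa [Submonoid.smul_def, Algebra.smul_def] using h⟩
  choose! n hn0 hn using hmul
  classical
  refine ⟨S.image fun s ↦ n s * s, by simpa using fun s hs ↦ hn s (hS s hs), fun x hx ↦ ?_⟩
  set B := Algebra.adjoin A ((S.image fun s ↦ n s * s : Finset L) : Set L)
  replace hx := hspan x hx.tower_top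
  induction hx using Submodule.span_induction with
  | mem x h =>
    exact ⟨n x, hn0 x (hS x h), Algebra.subset_adjoin (Finset.mem_image_of_mem _ h)⟩
  | zero => exact ⟨1, one_ne_zero, by simp⟩
  | add x y _ _ h₁ h₂ =>
    obtain ⟨a, ha, ha'⟩ := h₁
    obtain ⟨b, hb, hb'⟩ := h₂
    refine ⟨a * b, mul_ne_zero ha hb, ?_⟩
    convert add_mem (mul_mem (intCast_mem B b) ha') (mul_mem (intCast_mem B a) hb') using 1
    push_cast
    ring
  | smul r x _ h =>
    obtain ⟨a, ha, ha'⟩ := h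
    obtain ⟨⟨c, _, m, hm, rfl⟩, hc⟩ := IsLocalization.surj M r
    have := congrArg (algebraMap R L) hc
    refine ⟨m * a, mul_ne_zero (nonZeroDivisors.ne_zero hm) ha, ?_⟩
    convert mul_mem (B.algebraMap_mem c) ha' using 1
    rw [map_mul, ← IsScalarTower.algebraMap_apply, ← IsScalarTower.algebraMap_apply A R L] at this
    simp only [Algebra.smul_def, eq_intCast, map_intCast] at this ⊢
    push_cast
    linear_combination a * x * this

theorem isIntegrallyClosed_quotient_of_sub_mem {B E : Type*} [CommRing B] [CommRing E]
    (φ : B →+* E) {p : ℕ} (hker : ∀ b, (p : E) ∣ φ b → (p : B) ∣ b)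
    (hsurj : ∀ x : E, ∃ b, (p : E) ∣ x - φ b)
    (h : IsReduced (B ⧸ Ideal.span {(p : B)}) ∧ IsIntegrallyClosed (B ⧸ Ideal.span {(p : B)})) :
    IsReduced (E ⧸ Ideal.span {(p : E)}) ∧ IsIntegrallyClosed (E ⧸ Ideal.span {(p : E)}) := by
  obtain ⟨_, _⟩ := h
  let ψ : B →+* E ⧸ Ideal.span {(p : E)} := (Ideal.Quotient.mk _).comp φ
  have hψ : Function.Surjective ψ := by
    intro x
    obtain ⟨x, rfl⟩ := Ideal.Quotient.mk_surjective x
    obtain ⟨b, hb⟩ := hsurj x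
    exact ⟨b, (Ideal.Quotient.eq.mpr (Ideal.mem_span_singleton.mpr hb)).symm⟩
  have hk : Ideal.span {(p : B)} = RingHom.ker ψ := by
    ext b
    rw [RingHom.mem_ker, RingHom.comp_apply, Ideal.Quotient.eq_zero_iff_mem,
      Ideal.mem_span_singleton, Ideal.mem_span_singleton]
    exact ⟨fun hb ↦ by simpa using map_dvd φ hb, hker b⟩
  let e : B ⧸ Ideal.span {(p : B)} ≃+* E ⧸ Ideal.span {(p : E)} :=
    (Ideal.quotEquivOfEq hk).trans (RingHom.quotientKerEquivOfSurjective hψ)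
  exact ⟨isReduced_of_injective e.symm e.symm.injective, .of_equiv e⟩

theorem Subalgebra.mem_of_natCast_mul_mem {A L : Type*} [CommRing A] [Field L] [CharZero L]
    [Algebra A L] {B : Subalgebra A L} {p : ℕ} (hp : p ≠ 0)
    (hred : (Ideal.span {(p : B)}).IsRadical) {x : L} (hx : IsIntegral B x) (hpx : p * x ∈ B) :
    x ∈ B := by
  have h := hx.mem_of_algebraMap_mul_eq (C := B) (K := L) Subtype.val_injective hred
    (Ideal.mem_span_singleton_self (p : B)) (a := ⟨p * x, hpx⟩) (by
      rw [map_natCast]; rfl)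
  obtain ⟨b, hb⟩ := Ideal.mem_span_singleton.mp h
  have hb' : (p : L) * x = p * (b : L) := by simpa using congrArg (Subtype.val : B → L) hb
  rw [mul_left_cancel₀ (Nat.cast_ne_zero.mpr hp) hb']
  exact b.2

theorem Subalgebra.mem_of_natCast_pow_mul_mem {A L : Type*} [CommRing A] [Field L] [CharZero L]
    [Algebra A L] {B : Subalgebra A L} {p : ℕ} (hp : p ≠ 0)
    (hred : (Ideal.span {(p : B)}).IsRadical) {x : L} (hx : IsIntegral B x) (k : ℕ)
    (hpx : (p : L) ^ k * x ∈ B) : x ∈ B := by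
  induction k with
  | zero => simpa using hpx
  | succ k ih =>
    refine ih (Subalgebra.mem_of_natCast_mul_mem hp hred ?_ (by rwa [← mul_assoc, ← pow_succ']))
    rw [← Nat.cast_pow]
    exact (isIntegral_natCast _).mul hx

theorem integralClosure.exists_forall_prime_isIntegrallyClosed_quotient (A : Type) [CommRing A]
    [IsDomain A] [CharZero A] [Algebra.FiniteType ℤ A] (L : Type) [Field L] [Algebra A L]
    [IsFractionRing A L] :
    ∃ N : ℕ, ∀ p : ℕ, p.Prime → N < p →
      IsReduced (↥(integralClosure A L) ⧸ Ideal.span {(p : ↥(integralClosure A L))}) ∧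
      IsIntegrallyClosed (↥(integralClosure A L) ⧸
        Ideal.span {(p : ↥(integralClosure A L))}) := by
  obtain ⟨S, hS, hSn⟩ := Algebra.FiniteType.exists_finset_adjoin_integralClosure A L
  replace hSn (x : L) (hx : IsIntegral A x) :
      ∃ n : ℕ, n ≠ 0 ∧ n * x ∈ Algebra.adjoin A (S : Set L) := by
    obtain ⟨n, hn, hnx⟩ := hSn x hx
    refine ⟨n.natAbs, Int.natAbs_ne_zero.mpr hn, ?_⟩
    rcases Int.natAbs_eq n with h | h <;> rw [h] at hnx
    · simpa using hnx
    · simpa using neg_mem hnx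
  let B := Algebra.adjoin A (S : Set L)
  have hB : B ≤ integralClosure A L := Algebra.adjoin_le hS
  have : Algebra.FiniteType A B := ⟨(Subalgebra.fg_top B).mpr ⟨S, rfl⟩⟩
  have hft : Algebra.FiniteType ℤ B := Algebra.FiniteType.trans (S := A) inferInstance this
  have : CharZero L := charZero_of_injective_algebraMap (IsFractionRing.injective A L)
  have : CharZero B := ⟨fun m n h ↦ Nat.cast_injective (R := L) <| by
    simpa using congrArg (algebraMap B L) h⟩
  have hinj : Function.Injective (algebraMap B L) := Subtype.val_injective
  have : IsFractionRing B L := .of_field B L fun x ↦ by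
    obtain ⟨a, s, hs⟩ := IsFractionRing.div_surjective (A := A) x
    exact ⟨algebraMap A B a, algebraMap A B s, hs.2.symm⟩
  have : Algebra.IsIntegral A B :=
    ⟨fun b ↦ (isIntegral_algHom_iff B.val Subtype.val_injective).mp (hB b.2)⟩
  have hint (x : L) (hx : IsIntegral B x) : IsIntegral A x := isIntegral_trans x hx
  obtain ⟨N, hN⟩ := Algebra.FiniteType.exists_forall_prime_isIntegrallyClosed_quotient B (by
    intro x hx
    let e := FractionRing.algEquiv B L
    obtain ⟨n, hn, hnx⟩ := hSn (e x) (hint _ (hx.map e))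
    refine ⟨n, hn, ⟨_, hnx⟩, e.injective ?_⟩
    rw [e.commutes, map_mul, map_natCast]
    rfl)
  refine ⟨N, fun p hp hpN ↦ isIntegrallyClosed_quotient_of_sub_mem
    (Subalgebra.inclusion hB).toRingHom ?_ ?_ (hN p hp hpN)⟩
  all_goals
    have hred : (Ideal.span {(p : B)}).IsRadical :=
      (Ideal.isRadical_iff_quotient_reduced _).mpr (hN p hp hpN).1
  · rintro b ⟨x, hx⟩
    have hx' : (b : L) = p * (x : L) := by
      simpa using congrArg (Subtype.val : integralClosure A L → L) hx
    have hxB : (x : L) ∈ B := Subalgebra.mem_of_natCast_mul_mem hp.ne_zero hred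
      (IsIntegral.tower_top (R := A) x.2) (hx' ▸ b.2)
    exact ⟨⟨x, hxB⟩, Subtype.ext (by simpa using hx')⟩
  · intro x
    obtain ⟨n, hn, hnx⟩ := hSn x x.2
    obtain ⟨k, m, hm, hkm⟩ := Nat.exists_eq_pow_mul_and_not_dvd hn p hp.ne_one
    have hmx : (m : L) * x ∈ B := by
      refine Subalgebra.mem_of_natCast_pow_mul_mem hp.ne_zero hred
        ((isIntegral_natCast _).mul (IsIntegral.tower_top (R := A) x.2)) k ?_
      rwa [← mul_assoc, ← Nat.cast_pow, ← Nat.cast_mul, ← hkm]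
    obtain ⟨u, v, huv⟩ := Int.isCoprime_iff_gcd_eq_one.mpr
      ((Nat.coprime_comm.mp ((Nat.Prime.coprime_iff_not_dvd hp).mpr hm)) : Int.gcd m p = 1)
    have huv' : (u : L) * m + v * p = 1 := by exact_mod_cast huv
    refine ⟨u • ⟨_, hmx⟩, v • x, Subtype.ext ?_⟩
    simp
    linear_combination (-(x : L)) * huv'

theorem IsIntegrallyClosed.of_subsingleton (R : Type*) [CommRing R] [Subsingleton R] :
    IsIntegrallyClosed R := by
  have := (algebraMap R (FractionRing R)).codomain_trivial
  exact (isIntegrallyClosed_iff (FractionRing R)).mpr fun _ ↦ ⟨0, Subsingleton.elim _ _⟩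

set_option synthInstance.maxHeartbeats 400000 in
/-- Let `A` be a domain finitely generated as a `ℤ`-algebra and `Ã` its integral closure
in `Frac(A)`. Then there is `N > 0` such that for every prime `p > N`, the ring `Ã/pÃ` is
reduced and integrally closed in its total ring of fractions. -/
theorem normalization_mod_p_normal (A : Type) [CommRing A] [IsDomain A]
    [Algebra.FiniteType ℤ A] :
    ∃ N : ℕ, 0 < N ∧ ∀ p : ℕ, p.Prime → N < p →
      IsReduced (↥(integralClosure A (FractionRing A)) ⧸
        Ideal.span {(p : ↥(integralClosure A (FractionRing A)))}) ∧
      IsIntegrallyClosed (↥(integralClosure A (FractionRing A)) ⧸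
        Ideal.span {(p : ↥(integralClosure A (FractionRing A)))}) := by
  obtain ⟨ℓ, hℓ⟩ := CharP.exists A
  rcases Nat.eq_zero_or_pos ℓ with rfl | hpos
  · have : CharZero A := CharP.charP_to_charZero A
    obtain ⟨N, hN⟩ := integralClosure.exists_forall_prime_isIntegrallyClosed_quotient A
      (FractionRing A)
    exact ⟨N + 1, N.succ_pos, fun p hp h ↦ hN p hp (by lia)⟩
  · refine ⟨ℓ, hpos, fun p hp h ↦ ?_⟩
    have hu : IsUnit (p : integralClosure A (FractionRing A)) := by
      simpa using (hp.isUnit_cast_of_charP hpos.ne' h A).map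
        (algebraMap A (integralClosure A (FractionRing A)))
    have : Subsingleton (↥(integralClosure A (FractionRing A)) ⧸
        Ideal.span {(p : ↥(integralClosure A (FractionRing A)))}) :=
      Ideal.Quotient.subsingleton_iff.mpr (Ideal.span_singleton_eq_top.mpr hu)
    exact ⟨⟨fun x _ ↦ Subsingleton.elim x 0⟩, .of_subsingleton _⟩
end

section
/- Let A be a domain that is finitely generated as a ℤ-algebra, let Ã be the integral closure of A in its fraction field, and let D = {u ∈ A : u·ã ∈ A for all ã ∈ Ã} be the conductor ideal. For a prime p, let ι_p : A/pA → Ã/pÃ denote the induced map and let D(p) = {u ∈ A/pA : ι_p(u)·b ∈ range(ι_p) for all b ∈ Ã/pÃ}. Then there exists a positive integer N such that for every prime p > N, the image of D in A/pA is equal to D(p). -/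
set_option synthInstance.maxHeartbeats 1000000
set_option maxHeartbeats 1000000

theorem Int.isJacobsonRing : IsJacobsonRing ℤ := by
  rw [isJacobsonRing_iff_prime_eq]
  intro P hP
  by_cases h : P = ⊥
  · subst h
    refine le_antisymm (fun n hn ↦ ?_) Ideal.le_jacobson
    by_contra hn0
    obtain ⟨p, hnp, hp⟩ := Nat.exists_infinite_primes (n.natAbs + 1)
    have hmax : (Ideal.span {(p : ℤ)}).IsMaximal :=
      PrincipalIdealRing.isMaximal_of_irreducible (Nat.prime_iff_prime_int.mp hp).irreducible
    have hmem : n ∈ Ideal.span {(p : ℤ)} :=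
      Ideal.mem_sInf.mp hn ⟨bot_le, hmax⟩
    rw [Ideal.mem_span_singleton] at hmem
    have := Int.natAbs_le_of_dvd_ne_zero hmem hn0
    simp at this
    omega
  · have := hP.isMaximal h
    exact Ideal.jacobson_eq_self_of_isMaximal

theorem Ideal.IsMaximal.exists_prime_natCast_mem {A : Type*} [CommRing A] [Algebra.FiniteType ℤ A]
    (q : Ideal A) [q.IsMaximal] : ∃ p : ℕ, p.Prime ∧ (p : A) ∈ q := by
  let := Ideal.Quotient.field q
  have := Int.isJacobsonRing
  have : Module.Finite ℤ (A ⧸ q) := finite_of_finite_type_of_isJacobsonRing ℤ (A ⧸ q)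
  obtain ⟨p, hp⟩ := CharP.exists (A ⧸ q)
  rcases CharP.char_is_prime_or_zero (A ⧸ q) p with h | rfl
  · refine ⟨p, h, ?_⟩
    rw [← Ideal.Quotient.eq_zero_iff_mem, map_natCast, CharP.cast_eq_zero]
  · have := CharP.charP_to_charZero (A ⧸ q)
    exact absurd (isField_of_isIntegral_of_isField (R := ℤ) (S := A ⧸ q)
      (FaithfulSMul.algebraMap_injective ℤ _) (Field.toIsField _)) Int.not_isField

theorem IsNoetherian.exists_smul_eq_zero_of_natCast_torsion {A : Type*} [CommRing A]
    (Q : Type*) [AddCommGroup Q] [Module A Q] [IsNoetherian A Q] :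
    ∃ N : ℕ, 0 < N ∧ ∀ p : ℕ, p.Prime → N < p → ∀ x : Q, (p : A) • x = 0 → x = 0 := by
  let f : ℕ →o Submodule A Q :=
    { toFun := fun n ↦ LinearMap.ker (LinearMap.lsmul A Q (n.factorial : A))
      monotone' := fun m n hmn x hx ↦ by
        obtain ⟨k, hk⟩ := Nat.factorial_dvd_factorial hmn
        simp only [LinearMap.mem_ker, LinearMap.lsmul_apply] at hx ⊢
        rw [hk, Nat.cast_mul, mul_comm, mul_smul, hx, smul_zero] }
  obtain ⟨n, hn⟩ := monotone_stabilizes_iff_noetherian.mpr ‹IsNoetherian A Q› f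
  refine ⟨n + 1, by omega, fun p hp hnp x hx ↦ ?_⟩
  have hx' : x ∈ f n := by
    rw [hn p (by omega)]
    change (p.factorial : A) • x = 0
    obtain ⟨k, hk⟩ := Nat.dvd_factorial hp.pos le_rfl
    rw [hk, Nat.cast_mul, mul_comm, mul_smul, hx, smul_zero]
  change (n.factorial : A) • x = 0 at hx'
  have hc : IsCoprime (n.factorial : A) (p : A) := by
    have : Nat.Coprime n.factorial p :=
      ((hp.coprime_iff_not_dvd).mpr (by rw [hp.dvd_factorial]; omega)).symm
    simpa using (Nat.isCoprime_iff_coprime.mpr this).map (Int.castRingHom A)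
  obtain ⟨a, b, hab⟩ := hc
  rw [← one_smul A x, ← hab, add_smul, mul_smul, mul_smul, hx, hx', smul_zero, smul_zero, add_zero]

theorem MvPolynomial.injective_of_map_eq_zero {σ A : Type*} [CommRing A] [IsDomain A] [CharZero A]
    (p : ℕ) (hp : p.Prime) (f : MvPolynomial σ ℤ →+* A)
    (hf : ∀ F, f F = 0 → MvPolynomial.map (Int.castRingHom (ZMod p)) F = 0) :
    Function.Injective f := by
  rw [injective_iff_map_eq_zero]
  have key : ∀ (n : ℕ) (F : MvPolynomial σ ℤ), f F = 0 → ∀ m, (p : ℤ) ^ n ∣ F.coeff m := by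
    intro n
    induction n with
    | zero => simp
    | succ n ih =>
      intro F hF m
      obtain ⟨G, rfl⟩ := (MvPolynomial.C_dvd_iff_zmod p F).mpr (hf F hF)
      have hG : f G = 0 := by
        rw [map_mul] at hF
        refine (mul_eq_zero.mp hF).resolve_left ?_
        simpa using hp.ne_zero
      rw [MvPolynomial.coeff_C_mul, pow_succ']
      exact mul_dvd_mul_left _ (ih G hG m)
  intro F hF
  ext m
  rw [MvPolynomial.coeff_zero]
  by_contra h
  have h1 := Int.natAbs_le_of_dvd_ne_zero (key (F.coeff m).natAbs F hF m) h
  rw [Int.natAbs_pow, Int.natAbs_natCast] at h1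
  exact absurd (Nat.lt_pow_self hp.one_lt) (not_lt.mpr h1)

open TensorProduct in
theorem Module.Finite.fiber_of_quotient {R A : Type*} [CommRing R] [CommRing A] [Algebra R A]
    (P : Ideal R) [P.IsPrime] (c : R) (hc : c ∈ P)
    [Module.Finite R (A ⧸ Ideal.span {algebraMap R A c})] :
    Module.Finite P.ResidueField (P.Fiber A) := by
  obtain ⟨n, s, hs⟩ := Module.Finite.exists_fin (R := R) (M := A ⧸ Ideal.span {algebraMap R A c})
  choose a ha using fun i ↦ Ideal.Quotient.mk_surjective (s i)
  refine ⟨(Submodule.fg_def.mpr ⟨_, Set.finite_range (fun i ↦ (1 : P.ResidueField) ⊗ₜ[R] a i), ?_⟩)⟩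
  rw [eq_top_iff]
  rintro x -
  induction x using TensorProduct.induction_on with
  | zero => exact zero_mem _
  | add x y hx hy => exact add_mem hx hy
  | tmul k y =>
    have hy : Ideal.Quotient.mk (Ideal.span {algebraMap R A c}) y ∈ Submodule.span R (Set.range s) :=
      hs ▸ Submodule.mem_top
    obtain ⟨w, hw⟩ := (Submodule.mem_span_range_iff_exists_fun R).mp hy
    have hmem : y - ∑ i, w i • a i ∈ Ideal.span {algebraMap R A c} := by
      rw [← Ideal.Quotient.eq_zero_iff_mem, map_sub, ← hw, map_sum, sub_eq_zero]
      refine Finset.sum_congr rfl fun i _ ↦ ?_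
      rw [← ha i]
      rfl
    obtain ⟨z, hz⟩ := Ideal.mem_span_singleton.mp hmem
    have hy' : y = ∑ i, w i • a i + c • z := by
      rw [Algebra.smul_def, ← hz]; ring
    have h0 : k ⊗ₜ[R] (c • z) = 0 := by
      rw [← TensorProduct.smul_tmul, Algebra.smul_def,
        Ideal.algebraMap_residueField_eq_zero.mpr hc, zero_mul, TensorProduct.zero_tmul]
    rw [hy', TensorProduct.tmul_add, h0, add_zero, TensorProduct.tmul_sum]
    refine Submodule.sum_mem _ fun i _ ↦ ?_
    have : k ⊗ₜ[R] (w i • a i) = (w i • k) • ((1 : P.ResidueField) ⊗ₜ[R] a i) := by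
      rw [← TensorProduct.smul_tmul, TensorProduct.smul_tmul', smul_eq_mul, mul_one]
    rw [this]
    exact Submodule.smul_mem _ _ (Submodule.subset_span ⟨i, rfl⟩)

theorem Algebra.ZariskisMainProperty.of_finite_quotient {R A : Type*} [CommRing R] [CommRing A]
    [Algebra R A] [Algebra.FiniteType R A] (q : Ideal A) [q.IsPrime] (c : R)
    (hc : algebraMap R A c ∈ q) [Module.Finite R (A ⧸ Ideal.span {algebraMap R A c})] :
    Algebra.ZariskisMainProperty R q := by
  have := Module.Finite.fiber_of_quotient (A := A) (q.under R) c hc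
  let e := PrimeSpectrum.preimageHomeomorphFiber R A ⟨q.under R, inferInstance⟩
  let Q := e ⟨⟨q, ‹_›⟩, rfl⟩
  have : Algebra.QuasiFiniteAt R q :=
    .of_quasiFiniteAt_residueField (q.under R) q Q.asIdeal
      congr($(e.symm_apply_apply ⟨⟨q, ‹_›⟩, rfl⟩).1.asIdeal)
  exact .of_finiteType q

theorem exists_mvPolynomial_injective_zariskisMainProperty {A : Type*} [CommRing A] [IsDomain A]
    [CharZero A] [Algebra.FiniteType ℤ A] (q : Ideal A) [q.IsMaximal] :
    ∃ (n : ℕ) (f : MvPolynomial (Fin n) ℤ →ₐ[ℤ] A), Function.Injective f ∧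
      letI := f.toAlgebra
      Algebra.ZariskisMainProperty (MvPolynomial (Fin n) ℤ) q := by
  obtain ⟨p, hp, hpq⟩ := Ideal.IsMaximal.exists_prime_natCast_mem q
  have := Fact.mk hp
  have hle : Ideal.span {(p : A)} ≤ q := by simpa [Ideal.span_le]
  have hchar : CharP (A ⧸ Ideal.span {(p : A)}) p := CharP.quotient A p fun h ↦
    (Ideal.IsPrime.ne_top ‹q.IsMaximal›.isPrime) (Ideal.eq_top_of_isUnit_mem _ hpq h)
  have : Nontrivial (A ⧸ Ideal.span {(p : A)}) := CharP.nontrivial_of_char_ne_one hp.ne_one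
  let := ZMod.algebra (A ⧸ Ideal.span {(p : A)}) p
  have : IsScalarTower ℤ (ZMod p) (A ⧸ Ideal.span {(p : A)}) :=
    .of_algebraMap_eq' (Subsingleton.elim _ _)
  have : Algebra.FiniteType (ZMod p) (A ⧸ Ideal.span {(p : A)}) :=
    .of_restrictScalars_finiteType ℤ _ _
  obtain ⟨n, g, hg, hgf⟩ := exists_finite_inj_algHom_of_fg (ZMod p) (A ⧸ Ideal.span {(p : A)})
  choose y hy using fun i ↦ Ideal.Quotient.mk_surjective (g (MvPolynomial.X i))
  let f : MvPolynomial (Fin n) ℤ →ₐ[ℤ] A := MvPolynomial.aeval y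
  have hcomm : (Ideal.Quotient.mk (Ideal.span {(p : A)})).comp f.toRingHom =
      g.toRingHom.comp (MvPolynomial.map (Int.castRingHom (ZMod p))) := by
    apply MvPolynomial.ringHom_ext
    · intro r; simp
    · intro i; simp [f, hy]
  refine ⟨n, f, MvPolynomial.injective_of_map_eq_zero p hp f.toRingHom fun F hF ↦ ?_, ?_⟩
  · apply hg
    have := congr($hcomm F)
    simp only [RingHom.comp_apply, hF, map_zero] at this
    rw [map_zero]
    exact this.symm
  · let := f.toAlgebra
    have : Algebra.FiniteType (MvPolynomial (Fin n) ℤ) A :=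
      .of_restrictScalars_finiteType ℤ _ _
    have hpc : algebraMap (MvPolynomial (Fin n) ℤ) A p = p := map_natCast _ _
    have : Module.Finite (MvPolynomial (Fin n) ℤ)
        (A ⧸ Ideal.span {algebraMap (MvPolynomial (Fin n) ℤ) A p}) := by
      rw [hpc]
      have : ((Ideal.Quotient.mk (Ideal.span {(p : A)})).comp f.toRingHom).Finite := by
        rw [hcomm]
        exact RingHom.Finite.comp hgf
          (.of_surjective _ (MvPolynomial.map_surjective _ (ZMod.ringHom_surjective _)))
      exact this
    exact .of_finite_quotient q (p : MvPolynomial (Fin n) ℤ) (hpc ▸ hpq)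

theorem IsIntegral.exists_pow_smul {R A K : Type*} [CommRing R] [CommRing A] [CommRing K]
    [Algebra R A] [Algebra A K] [Algebra R K] [IsScalarTower R A K] {r : A}
    (H : ∀ x : A, ∃ m, IsIntegral R (r ^ m * x)) (hr : IsIntegral R r) {b : K}
    (hb : IsIntegral A b) :
    ∃ n, IsIntegral R (r ^ n • b) := by
  obtain ⟨P, hP, hPb⟩ := hb
  choose m hm using H
  let M := P.support.sup fun i ↦ m (P.coeff i)
  have hM : ∀ i, IsIntegral R (r ^ M * P.coeff i) := by
    intro i
    by_cases hi : i ∈ P.support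
    · have : m (P.coeff i) ≤ M := Finset.le_sup (f := fun i ↦ m (P.coeff i)) hi
      obtain ⟨k, hk⟩ := Nat.exists_eq_add_of_le this
      have := (hr.pow k).mul (hm (P.coeff i))
      rwa [← mul_assoc, ← pow_add, add_comm k, ← hk] at this
    · rw [Polynomial.notMem_support_iff.mp hi, mul_zero]
      exact isIntegral_zero
  let R' := integralClosure R A
  have hlift : P.scaleRoots (r ^ M) ∈ Polynomial.lifts (algebraMap R' A) := by
    rw [Polynomial.lifts_iff_coeff_lifts]
    intro i
    rw [Polynomial.coeff_scaleRoots]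
    suffices h : IsIntegral R (P.coeff i * (r ^ M) ^ (P.natDegree - i)) from ⟨⟨_, h⟩, rfl⟩
    rcases lt_trichotomy i P.natDegree with h | h | h
    · obtain ⟨k, hk⟩ := Nat.exists_eq_add_of_lt h
      rw [show P.natDegree - i = k + 1 by omega, pow_succ', ← mul_assoc, mul_comm (P.coeff i)]
      exact (hM i).mul ((hr.pow M).pow k)
    · rw [h, Nat.sub_self, pow_zero, mul_one, hP.coeff_natDegree]
      exact isIntegral_one
    · rw [Polynomial.coeff_eq_zero_of_natDegree_lt h, zero_mul]
      exact isIntegral_zero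
  obtain ⟨S, hS, -, hSm⟩ := Polynomial.lifts_and_natDegree_eq_and_monic hlift
    ((Polynomial.monic_scaleRoots_iff _).mpr hP)
  refine ⟨M, isIntegral_trans (A := R') _ ⟨S, hSm, ?_⟩⟩
  have h0 := Polynomial.scaleRoots_aeval_eq_zero (r := r ^ M)
    (show Polynomial.aeval b P = 0 from hPb)
  rw [← hS, Polynomial.aeval_map_algebraMap, ← Algebra.smul_def] at h0
  exact h0

theorem Algebra.ZariskisMainProperty.exists_fg_le_integralClosure {R A : Type*} [CommRing R]
    [IsDomain R] [CharZero R] [IsNoetherianRing R] [IsIntegrallyClosed R] [CommRing A]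
    [IsDomain A] [Algebra R A] [FaithfulSMul R A] [Algebra.FiniteType R A] {q : Ideal A}
    (h : Algebra.ZariskisMainProperty R q) :
    ∃ r ∉ q, ∃ F : Submodule A (FractionRing A), F.FG ∧
      F ≤ Subalgebra.toSubmodule (integralClosure A (FractionRing A)) ∧
      ∀ b : FractionRing A, IsIntegral A b → ∃ n : ℕ, r ^ n • b ∈ F := by
  obtain ⟨r, hrq, hr, H⟩ := Algebra.zariskisMainProperty_iff.mp h
  have hr0 : r ≠ 0 := fun h ↦ hrq (h ▸ zero_mem q)
  let K := FractionRing R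
  let L := FractionRing A
  have : FaithfulSMul R L := .trans R A L
  let := FractionRing.liftAlgebra R L
  have := FractionRing.isScalarTower_liftAlgebra R L
  have : Algebra.IsAlgebraic R A := ⟨fun x ↦ by
    obtain ⟨m, hm⟩ := H x
    exact .of_mul (mem_nonZeroDivisors_of_ne_zero (pow_ne_zero m hr0)) (hr.pow m).isAlgebraic
      hm.isAlgebraic⟩
  have : Algebra.IsAlgebraic R L := (IsFractionRing.isAlgebraic_iff' R A L).mp inferInstance
  have : Algebra.IsAlgebraic K L := (IsFractionRing.comap_isAlgebraic_iff (A := R)).mp inferInstance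
  have : Algebra.EssFiniteType A L := .of_isLocalization _ (nonZeroDivisors A)
  have : Algebra.EssFiniteType R L := .comp R A L
  have : Algebra.EssFiniteType K L := .of_comp R K L
  have : FiniteDimensional K L := Algebra.finite_of_essFiniteType_of_isAlgebraic
  have : CharZero K := charZero_of_injective_algebraMap (FaithfulSMul.algebraMap_injective R K)
  have : Module.Finite R (integralClosure R L) := IsIntegralClosure.finite R K L _
  obtain ⟨s, hs⟩ := Module.Finite.iff_fg
    (N := Subalgebra.toSubmodule (integralClosure R L)).mp this
  refine ⟨r, hrq, Submodule.span A s, ⟨s, rfl⟩, ?_, fun b hb ↦ ?_⟩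
  · rw [Submodule.span_le]
    intro x hx
    have : x ∈ Subalgebra.toSubmodule (integralClosure R L) := hs ▸ Submodule.subset_span hx
    exact _root_.IsIntegral.tower_top (R := R) this
  · obtain ⟨n, hn⟩ := IsIntegral.exists_pow_smul (R := R) H hr hb
    refine ⟨n, ?_⟩
    have : r ^ n • b ∈ Submodule.span R (s : Set L) := by rw [hs]; exact hn
    exact Submodule.span_subset_span R A _ this

theorem integralClosure_finite {A : Type*} [CommRing A] [IsDomain A]
    (H : ∀ q : Ideal A, q.IsMaximal → ∃ r ∉ q, ∃ F : Submodule A (FractionRing A), F.FG ∧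
      F ≤ Subalgebra.toSubmodule (integralClosure A (FractionRing A)) ∧
      ∀ b : FractionRing A, IsIntegral A b → ∃ n : ℕ, r ^ n • b ∈ F) :
    Module.Finite A (integralClosure A (FractionRing A)) := by
  let B := Subalgebra.toSubmodule (integralClosure A (FractionRing A))
  let S : Set A := {r | ∃ F : Submodule A (FractionRing A), F.FG ∧ F ≤ B ∧
      ∀ b : FractionRing A, IsIntegral A b → ∃ n : ℕ, r ^ n • b ∈ F}
  have hS : Ideal.span S = ⊤ := by
    by_contra h
    obtain ⟨q, hq, hSq⟩ := Ideal.exists_le_maximal _ h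
    obtain ⟨r, hr, hF⟩ := H q hq
    exact hr (hSq (Ideal.subset_span hF))
  obtain ⟨T, hTS, hT⟩ := (Ideal.span_eq_top_iff_finite S).mp hS
  choose! F hF hFB hFr using fun (r : A) (hr : r ∈ S) ↦ hr
  have hB : B = T.sup F := by
    refine le_antisymm (fun b hb ↦ ?_) (Finset.sup_le fun r hr ↦ hFB r (hTS hr))
    refine Submodule.mem_of_span_eq_top_of_smul_pow_mem _ (T : Set A) hT b fun r ↦ ?_
    obtain ⟨n, hn⟩ := hFr r (hTS r.2) b hb
    exact ⟨n, Finset.le_sup (f := F) r.2 hn⟩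
  have : B.FG := hB ▸ Submodule.fg_finset_sup T F fun r hr ↦ hF r (hTS hr)
  exact Module.Finite.iff_fg.mpr this

theorem Module.Finite.exists_conductor_lift_mod_prime {A B : Type*} [CommRing A] [CommRing B] [Algebra A B]
    [IsNoetherianRing A] [Module.Finite A B] :
    ∃ N : ℕ, 0 < N ∧ ∀ p : ℕ, p.Prime → N < p → ∀ u : A,
      (∀ b : B, ∃ (a : A) (c : B), algebraMap A B u * b = algebraMap A B a + (p : B) * c) →
      ∃ v : A, (∀ b : B, algebraMap A B v * b ∈ Set.range (algebraMap A B)) ∧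
        ∃ w : A, v = u + p * w := by
  obtain ⟨n, s, hs⟩ := Module.Finite.exists_fin (R := A) (M := B)
  let C := LinearMap.range (Algebra.linearMap A B)
  have hC : ∀ x, C.mkQ x = 0 ↔ x ∈ Set.range (algebraMap A B) := fun x ↦
    Submodule.Quotient.mk_eq_zero C
  let φ : A →ₗ[A] (Fin n → B ⧸ C) := LinearMap.pi fun i ↦
    C.mkQ ∘ₗ LinearMap.toSpanSingleton A B (s i)
  have hφ : ∀ a i, φ a i = C.mkQ (a • s i) := fun _ _ ↦ rfl
  obtain ⟨N, hN, hNp⟩ := IsNoetherian.exists_smul_eq_zero_of_natCast_torsion (A := A)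
    ((Fin n → B ⧸ C) ⧸ LinearMap.range φ)
  refine ⟨N, hN, fun p hp hpN u hu ↦ ?_⟩
  choose a c hac using fun i ↦ hu (s i)
  have hpφ : (p : A) • (fun i ↦ C.mkQ (c i)) = φ u := by
    ext i
    have h1 : (p : A) • c i = u • s i - algebraMap A B (a i) := by
      rw [Algebra.smul_def, Algebra.smul_def, hac i, map_natCast]; ring
    rw [hφ, Pi.smul_apply, ← map_smul, h1, map_sub, (hC _).mpr ⟨_, rfl⟩, sub_zero]
  have hmem := hNp p hp hpN (Submodule.Quotient.mk fun i ↦ C.mkQ (c i)) (by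
    rw [← Submodule.Quotient.mk_smul, hpφ, Submodule.Quotient.mk_eq_zero]
    exact ⟨u, rfl⟩)
  rw [Submodule.Quotient.mk_eq_zero] at hmem
  obtain ⟨w, hw⟩ := hmem
  have hker : φ (u - p * w) = 0 := by
    rw [map_sub, ← hpφ, ← smul_eq_mul, map_smul, hw, sub_self]
  refine ⟨u - p * w, fun b ↦ ?_, -w, by ring⟩
  have hb : b ∈ Submodule.span A (Set.range s) := hs ▸ Submodule.mem_top
  rw [← hC, ← Algebra.smul_def]
  induction hb using Submodule.span_induction with
  | mem x hx =>
    obtain ⟨i, rfl⟩ := hx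
    rw [← hφ, hker, Pi.zero_apply]
  | zero => simp
  | add x y _ _ hx hy => rw [smul_add, map_add, hx, hy, add_zero]
  | smul k x _ hx => rw [smul_comm, map_smul, hx, smul_zero]

theorem Algebra.FiniteType.finite_integralClosure_fractionRing {A : Type*} [CommRing A] [IsDomain A]
    [CharZero A] [Algebra.FiniteType ℤ A] :
    Module.Finite A (integralClosure A (FractionRing A)) := by
  refine integralClosure_finite fun q hq ↦ ?_
  obtain ⟨n, f, hf, h⟩ := exists_mvPolynomial_injective_zariskisMainProperty q
  let := f.toAlgebra
  have : FaithfulSMul (MvPolynomial (Fin n) ℤ) A := (faithfulSMul_iff_algebraMap_injective _ _).mpr hf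
  have : Algebra.FiniteType (MvPolynomial (Fin n) ℤ) A := .of_restrictScalars_finiteType ℤ _ _
  exact h.exists_fg_le_integralClosure

theorem Ideal.Quotient.subsingleton_of_charP_of_lt {A : Type*} [CommRing A] (q : ℕ) [CharP A q]
    (hq : q.Prime) {p : ℕ} (hp : p.Prime) (hqp : q < p) :
    Subsingleton (A ⧸ Ideal.span {(p : A)}) := by
  have h : IsCoprime (q : A) (p : A) := by
    simpa using (Nat.isCoprime_iff_coprime.mpr
      ((Nat.coprime_primes hq hp).mpr hqp.ne)).map (Int.castRingHom A)
  rw [CharP.cast_eq_zero, isCoprime_zero_left] at h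
  rw [Ideal.Quotient.subsingleton_iff, Ideal.span_singleton_eq_top]
  exact h

theorem reduceModP_mk {A B : Type*} [CommRing A] [CommRing B] (f : A →+* B) (p : ℕ) (a : A) :
    reduceModP f p (Ideal.Quotient.mk _ a) = Ideal.Quotient.mk _ (f a) :=
  rfl

theorem reduceModP_mul_mem_range_iff {A B : Type*} [CommRing A] [CommRing B] (f : A →+* B) (p : ℕ)
    (u : A) (b : B) :
    reduceModP f p (Ideal.Quotient.mk _ u) * Ideal.Quotient.mk _ b ∈ Set.range (reduceModP f p) ↔
      ∃ (a : A) (c : B), f u * b = f a + (p : B) * c := by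
  constructor
  · rintro ⟨x, hx⟩
    obtain ⟨a, rfl⟩ := Ideal.Quotient.mk_surjective x
    rw [reduceModP_mk, reduceModP_mk, ← map_mul, eq_comm, Ideal.Quotient.eq,
      Ideal.mem_span_singleton] at hx
    obtain ⟨c, hc⟩ := hx
    exact ⟨a, c, by rw [← hc]; ring⟩
  · rintro ⟨a, c, h⟩
    refine ⟨Ideal.Quotient.mk _ a, ?_⟩
    rw [reduceModP_mk, reduceModP_mk, ← map_mul, eq_comm, Ideal.Quotient.eq,
      Ideal.mem_span_singleton]
    exact ⟨c, by rw [h]; ring⟩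

/-- Let `A` be a domain finitely generated as a `ℤ`-algebra, `Ã` its integral closure in
`Frac(A)`, and `D = {u ∈ A : u·ã ∈ A for all ã ∈ Ã}` the conductor. For a prime `p`, let
`ι_p : A/pA → Ã/pÃ` be the induced map and
`D(p) = {u ∈ A/pA : ι_p(u)·b ∈ range ι_p for all b ∈ Ã/pÃ}`. Then there is `N > 0` such
that for every prime `p > N`, the image of `D` in `A/pA` equals `D(p)`. -/
theorem conductor_mod_p (A : Type) [CommRing A] [IsDomain A] [Algebra.FiniteType ℤ A] :
    ∃ N : ℕ, 0 < N ∧ ∀ p : ℕ, p.Prime → N < p →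
      (Ideal.Quotient.mk (Ideal.span {(p : A)})) ''
          {u : A | ∀ b : ↥(integralClosure A (FractionRing A)),
            algebraMap A (FractionRing A) u * (b : FractionRing A) ∈
              Set.range (algebraMap A (FractionRing A))}
        = {u : A ⧸ Ideal.span {(p : A)} |
            ∀ b : ↥(integralClosure A (FractionRing A)) ⧸
                Ideal.span {(p : ↥(integralClosure A (FractionRing A)))},
              reduceModP (algebraMap A ↥(integralClosure A (FractionRing A))) p u * b ∈
                Set.range (reduceModP (algebraMap A ↥(integralClosure A (FractionRing A))) p)} := by
  obtain ⟨q, hq⟩ := CharP.exists A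
  rcases CharP.char_is_prime_or_zero A q with hq' | rfl
  · refine ⟨q, hq'.pos, fun p hp hqp ↦ ?_⟩
    have := Ideal.Quotient.subsingleton_of_charP_of_lt (A := A) q hq' hp hqp
    ext u
    obtain rfl : u = 0 := Subsingleton.elim _ _
    refine iff_of_true ⟨0, fun b ↦ ⟨0, by simp⟩, map_zero _⟩ fun b ↦ ⟨0, by simp⟩
  · have := CharP.charP_to_charZero A
    have : IsNoetherianRing A := Algebra.FiniteType.isNoetherianRing ℤ A
    have := Algebra.FiniteType.finite_integralClosure_fractionRing (A := A)
    obtain ⟨N, hN, h⟩ := Module.Finite.exists_conductor_lift_mod_prime (A := A) (B := integralClosure A (FractionRing A))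
    refine ⟨N, hN, fun p hp hpN ↦ ?_⟩
    ext u
    constructor
    · rintro ⟨v, hv, rfl⟩ b
      obtain ⟨b, rfl⟩ := Ideal.Quotient.mk_surjective b
      obtain ⟨a, ha⟩ := hv b
      exact (reduceModP_mul_mem_range_iff _ p v b).mpr
        ⟨a, 0, by rw [mul_zero, add_zero]; exact Subtype.ext ha.symm⟩
    · intro hu
      obtain ⟨u, rfl⟩ := Ideal.Quotient.mk_surjective u
      obtain ⟨v, hv, w, hw⟩ := h p hp hpN u fun b ↦
        (reduceModP_mul_mem_range_iff _ p u b).mp (hu (Ideal.Quotient.mk _ b))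
      refine ⟨v, fun b ↦ ?_, ?_⟩
      · obtain ⟨a, ha⟩ := hv b
        exact ⟨a, congr($ha.1)⟩
      · rw [Ideal.Quotient.eq, Ideal.mem_span_singleton]
        exact ⟨w, by rw [hw]; ring⟩
end

section
/- Let p be a prime, let S be a commutative ring of characteristic p, let R be a subring of S, and let φ : S → S be a function satisfying φ(a+b) = φ(a)+φ(b) and φ(aᵖ·b) = a·φ(b) for all a, b ∈ S, with φ(R) ⊆ R. Then the conductor C = {u ∈ R : u·s ∈ R for all s ∈ S} satisfies φ(C) ⊆ C. -/
/-- Let `p` be a prime, `S` a commutative ring of characteristic `p`, `R` a subring of `S`,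
and `φ : S → S` a near Frobenius splitting (`φ(a+b) = φ(a)+φ(b)` and `φ(a^p * b) = a * φ(b)`)
with `φ(R) ⊆ R`. Then the conductor `C = {u ∈ R : u·s ∈ R for all s ∈ S}` satisfies
`φ(C) ⊆ C`. -/
theorem conductor_compatibly_split (p : ℕ) (hp : p.Prime) (S : Type) [CommRing S]
    [CharP S p] (R : Subring S) (φ : S → S)
    (hadd : ∀ a b : S, φ (a + b) = φ a + φ b)
    (hmul : ∀ a b : S, φ (a ^ p * b) = a * φ b)
    (hR : ∀ r : S, r ∈ R → φ r ∈ R) :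
    ∀ u ∈ {u : S | u ∈ R ∧ ∀ s : S, u * s ∈ R},
      φ u ∈ {u : S | u ∈ R ∧ ∀ s : S, u * s ∈ R} := by
  rintro u ⟨hu, hus⟩
  refine ⟨hR u hu, fun s => ?_⟩
  rw [mul_comm, ← hmul, mul_comm]
  exact hR _ (hus (s ^ p))
end

section
/- Let p be a prime, let A be a domain of characteristic p with fraction field K, and let φ : A → A be a function satisfying φ(a+b) = φ(a)+φ(b), φ(aᵖ·b) = a·φ(b) for all a, b ∈ A, and φ(1) = 1. Then there exists a unique function φ̂ : K → K satisfying φ̂(x+y) = φ̂(x)+φ̂(y), φ̂(xᵖ·y) = x·φ̂(y) for all x, y ∈ K, and φ̂(1) = 1, such that φ̂ agrees with φ on (the image of) A. -/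
/-- A map `φ` with `φ (a ^ (q + 1) * b) = a * φ b` on a domain extends to its fraction
field by the formula `a / b ↦ φ (a * b ^ q) / b`. -/
theorem exists_map_div_eq {A K : Type*} [CommRing A] [IsDomain A] [Field K] [Algebra A K]
    [IsFractionRing A K] (q : ℕ) (φ : A → A)
    (hmul : ∀ a b : A, φ (a ^ (q + 1) * b) = a * φ b) :
    ∃ φh : K → K, ∀ a b : A, b ≠ 0 →
      φh (algebraMap A K a / algebraMap A K b) =
        algebraMap A K (φ (a * b ^ q)) / algebraMap A K b := by
  have hinj := IsFractionRing.injective A K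
  choose num den hden hdiv using IsFractionRing.div_surjective (A := A) (K := K)
  refine ⟨fun x => algebraMap A K (φ (num x * den x ^ q)) / algebraMap A K (den x),
    fun a b hb => ?_⟩
  generalize hx : algebraMap A K a / algebraMap A K b = x
  have hd : den x ≠ 0 := nonZeroDivisors.ne_zero (hden x)
  have hbK : algebraMap A K b ≠ 0 := (map_ne_zero_iff _ hinj).2 hb
  have hdK : algebraMap A K (den x) ≠ 0 := (map_ne_zero_iff _ hinj).2 hd
  have hcross : num x * b = a * den x := by
    apply hinj
    rw [map_mul, map_mul, ← div_eq_div_iff hdK hbK, hdiv, hx]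
  have key : φ (num x * den x ^ q) * b = φ (a * b ^ q) * den x := by
    rw [mul_comm, mul_comm _ (den x), ← hmul, ← hmul]
    congr 1
    linear_combination (b ^ q * den x ^ q) * hcross
  rw [div_eq_div_iff hdK hbK, ← map_mul, ← map_mul, key]

/-- Let `p` be a prime, `A` a domain of characteristic `p` with fraction field `K`, and
`φ : A → A` a Frobenius splitting. Then there is a unique Frobenius splitting
`φ̂ : K → K` agreeing with `φ` on (the image of) `A`. -/
theorem splitting_extends_to_fractionField (p : ℕ) (hp : p.Prime)
    (A : Type) [CommRing A] [IsDomain A] [CharP A p]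
    (K : Type) [Field K] [Algebra A K] [IsFractionRing A K]
    (φ : A → A)
    (hadd : ∀ a b : A, φ (a + b) = φ a + φ b)
    (hmul : ∀ a b : A, φ (a ^ p * b) = a * φ b)
    (hone : φ 1 = 1) :
    ∃! φh : K → K,
      (∀ x y : K, φh (x + y) = φh x + φh y) ∧
      (∀ x y : K, φh (x ^ p * y) = x * φh y) ∧
      φh 1 = 1 ∧
      (∀ a : A, φh (algebraMap A K a) = algebraMap A K (φ a)) := by
  obtain ⟨q, rfl⟩ : ∃ q, p = q + 1 := ⟨p - 1, (Nat.succ_pred hp.ne_zero).symm⟩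
  have hne {b : A} (hb : b ≠ 0) : algebraMap A K b ≠ 0 :=
    (map_ne_zero_iff _ (IsFractionRing.injective A K)).2 hb
  have hfrac (x : K) : ∃ a b : A, b ≠ 0 ∧ algebraMap A K a / algebraMap A K b = x := by
    obtain ⟨a, b, hb, hx⟩ := IsFractionRing.div_surjective (A := A) x
    exact ⟨a, b, nonZeroDivisors.ne_zero hb, hx⟩
  obtain ⟨φh, hφh⟩ := exists_map_div_eq (K := K) q φ hmul
  have hext (a : A) : φh (algebraMap A K a) = algebraMap A K (φ a) := by
    simpa using hφh a 1 one_ne_zero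
  refine ⟨φh, ⟨fun x y => ?_, fun x y => ?_, ?_, hext⟩, ?_⟩
  · obtain ⟨a, b, hb, rfl⟩ := hfrac x
    obtain ⟨c, d, hd, rfl⟩ := hfrac y
    have hbK := hne hb
    have hdK := hne hd
    have hnum : φ ((a * d + b * c) * (b * d) ^ q) =
        d * φ (a * b ^ q) + b * φ (c * d ^ q) := by
      rw [← hmul, ← hmul, ← hadd]
      congr 1
      ring
    rw [div_add_div _ _ hbK hdK, ← map_mul, ← map_mul, ← map_mul, ← map_add,
      hφh _ _ (mul_ne_zero hb hd), hφh _ _ hb, hφh _ _ hd, hnum]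
    simp only [map_add, map_mul]
    field_simp
  · obtain ⟨a, b, hb, rfl⟩ := hfrac x
    obtain ⟨c, d, hd, rfl⟩ := hfrac y
    have hbK := hne hb
    have hdK := hne hd
    have hnum : φ (a ^ (q + 1) * c * (b ^ (q + 1) * d) ^ q) = a * b ^ q * φ (c * d ^ q) := by
      rw [← hmul]
      congr 1
      ring
    rw [div_pow, div_mul_div_comm, ← map_pow, ← map_pow, ← map_mul, ← map_mul,
      hφh _ _ (mul_ne_zero (pow_ne_zero _ hb) hd), hφh _ _ hd, hnum]
    simp only [map_mul, map_pow]
    field_simp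
    ring
  · simpa [hone] using hext 1
  · rintro ψ ⟨-, hψmul, -, hψ⟩
    funext x
    obtain ⟨a, b, hb, rfl⟩ := hfrac x
    have hbK := hne hb
    have hclear : algebraMap A K (a * b ^ q) =
        algebraMap A K b ^ (q + 1) * (algebraMap A K a / algebraMap A K b) := by
      simp only [map_mul, map_pow]
      field_simp
      ring
    rw [hφh _ _ hb, eq_div_iff hbK, mul_comm, ← hψmul, ← hclear, hψ]
end

section
/- Let R = 𝔽₂[x, x⁻¹] be the ring of Laurent polynomials over the field with two elements, and let φ : R → R be a function satisfying φ(a+b) = φ(a)+φ(b), φ(a²·b) = a·φ(b) for all a, b ∈ R, and φ(1) = 1, such that φ(x + x⁻¹) = x + x⁻¹. Then φ(x) = x + 1, and consequently the ideal generated by x + 1 is not compatibly split: x + 1 lies in the ideal (x+1) but φ(x+1) = x does not lie in (x+1). -/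
open LaurentPolynomial in
/-- In `R = 𝔽₂[x, x⁻¹]`, if `φ : R → R` is a Frobenius splitting with
`φ(x + x⁻¹) = x + x⁻¹`, then `φ(x) = x + 1`; consequently the ideal `(x+1)` is not
compatibly split: `x + 1 ∈ (x+1)` but `φ(x+1) = x ∉ (x+1)`. -/
theorem laurent_example (φ : LaurentPolynomial (ZMod 2) → LaurentPolynomial (ZMod 2))
    (hadd : ∀ a b, φ (a + b) = φ a + φ b)
    (hmul : ∀ a b, φ (a ^ 2 * b) = a * φ b)
    (hone : φ 1 = 1)
    (hfix : φ (T 1 + T (-1)) = T 1 + T (-1)) :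
    φ (T 1) = T 1 + 1 ∧
      (T 1 + 1 : LaurentPolynomial (ZMod 2)) ∈
        Ideal.span {(T 1 + 1 : LaurentPolynomial (ZMod 2))} ∧
      φ (T 1 + 1) = T 1 ∧
      (T 1 : LaurentPolynomial (ZMod 2)) ∉
        Ideal.span {(T 1 + 1 : LaurentPolynomial (ZMod 2))} := by
  have h_two : (2 : LaurentPolynomial (ZMod 2)) = 0 := by
    have h := congrArg (C : ZMod 2 →+* LaurentPolynomial (ZMod 2)) (show (2 : ZMod 2) = 0 from rfl)
    simpa only [map_ofNat, map_zero] using h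
  have h_inv : (T 1 * T (-1) : LaurentPolynomial (ZMod 2)) = 1 := by
    rw [← T_add, add_neg_cancel, T_zero]
  have h_ne : (T 1 + 1 : LaurentPolynomial (ZMod 2)) ≠ 0 := by
    intro h
    have h_eq : (T 1 : LaurentPolynomial (ZMod 2)) = T 0 := by
      rw [T_zero]; linear_combination h - h_two
    have h_single := Finsupp.single_left_injective (one_ne_zero : (1 : ZMod 2) ≠ 0)
      (congrArg AddMonoidAlgebra.coeff h_eq)
    exact one_ne_zero h_single
  have h_neg : φ (T (-1)) = T (-1) * φ (T 1) := by
    rw [← hmul]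
    congr 1
    linear_combination -T (-1) * h_inv
  have h_phi : φ (T 1) = T 1 + 1 := by
    rw [hadd, h_neg] at hfix
    apply mul_left_cancel₀ h_ne
    linear_combination T 1 * hfix + (1 - φ (T 1)) * h_inv - T 1 * h_two
  refine ⟨h_phi, Ideal.mem_span_singleton_self _, ?_, ?_⟩
  · rw [hadd, h_phi, hone]
    linear_combination h_two
  · rw [Ideal.mem_span_singleton]
    rintro ⟨c, hc⟩
    have h := congrArg (eval₂ (RingHom.id (ZMod 2)) 1) hc
    rw [map_mul, map_add, map_one, eval₂_T] at h
    simp only [one_zpow, Units.val_one] at h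
    rw [show (1 + 1 : ZMod 2) = 0 from rfl, zero_mul] at h
    exact one_ne_zero h
end

section
/- Let p be an odd prime. In the polynomial ring 𝔽_p[u], the following identity holds: ∑_{k=0}^{p-1} c_k u^k = (u² − 4)^{(p−1)/2}, where c_k denotes the coefficient of the monomial u^k v^{p−1} w^{p−1} in the polynomial (uvw − v² − w²)^{p−1} ∈ 𝔽_p[u, v, w]. -/
theorem ZMod.choose_prime_sub_one {p : ℕ} (hp : p.Prime) {k : ℕ} (hk : k < p) :
    ((p - 1).choose k : ZMod p) = (-1) ^ k := by
  induction k with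
  | zero => simp
  | succ k ih =>
    have h := Nat.choose_succ_succ (p - 1) k
    rw [Nat.succ_eq_add_one, Nat.succ_eq_add_one, Nat.sub_add_cancel hp.one_le] at h
    have h0 : (p.choose (k + 1) : ZMod p) = 0 :=
      (ZMod.natCast_eq_zero_iff _ _).2 (hp.dvd_choose_self k.succ_ne_zero hk)
    rw [h, Nat.cast_add, ih (by omega)] at h0
    rw [pow_succ]
    linear_combination h0

theorem ZMod.choose_half_mul_neg_four_pow {p m : ℕ} (hp : p.Prime) (hm : p = 2 * m + 1) {j : ℕ}
    (hj : j ≤ m) : (m.choose j : ZMod p) * (-4) ^ j = j.centralBinom := by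
  have : Fact p.Prime := ⟨hp⟩
  induction j with
  | zero => simp
  | succ j ih =>
    have hne : ((j + 1 : ℕ) : ZMod p) ≠ 0 := fun h =>
      absurd (Nat.le_of_dvd j.succ_pos ((ZMod.natCast_eq_zero_iff _ _).1 h)) (by omega)
    have hm' : 2 * (m : ZMod p) + 1 = 0 := by
      have h : ((2 * m + 1 : ℕ) : ZMod p) = 0 := by rw [← hm, ZMod.natCast_self]
      exact_mod_cast h
    have h₁ := congrArg (Nat.cast (R := ZMod p)) (Nat.succ_mul_centralBinom_succ j)
    have h₂ := congrArg (Nat.cast (R := ZMod p)) (Nat.choose_succ_right_eq m j)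
    rw [Nat.cast_mul, Nat.cast_mul, Nat.cast_sub (by omega)] at h₂
    push_cast at h₁ h₂ hne
    apply mul_left_cancel₀ hne
    rw [h₁, ← ih (by omega), pow_succ]
    linear_combination (-4) ^ j * (-4) * h₂ - 2 * (m.choose j : ZMod p) * (-4) ^ j * hm'

theorem Finset.sum_range_two_mul_add_one_of_odd_eq_zero {M : Type*} [AddCommMonoid M] (f : ℕ → M)
    (hf : ∀ j, f (2 * j + 1) = 0) (m : ℕ) :
    ∑ i ∈ Finset.range (2 * m + 1), f i = ∑ j ∈ Finset.range (m + 1), f (2 * j) := by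
  induction m with
  | zero => simp
  | succ m ih =>
    rw [Finset.sum_range_succ _ (m + 1), ← ih, mul_add, mul_one, Finset.sum_range_succ,
      Finset.sum_range_succ, hf, add_zero]

open MvPolynomial in
theorem MvPolynomial.sub_sq_sub_sq_pow_eq_sum {R : Type*} [CommRing R] (n : ℕ) :
    (X 0 * X 1 * X 2 - X 1 ^ 2 - X 2 ^ 2 : MvPolynomial (Fin 3) R) ^ n =
      ∑ i ∈ Finset.range (n + 1), ∑ j ∈ Finset.range (i + 1),
        monomial (Finsupp.single 0 (n - i) + Finsupp.single 1 (n - i + 2 * j) +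
          Finsupp.single 2 (n - i + 2 * (i - j))) ((-1) ^ i * n.choose i * i.choose j : R) := by
  have h : (X 0 * X 1 * X 2 - X 1 ^ 2 - X 2 ^ 2 : MvPolynomial (Fin 3) R) =
      -(X 1 ^ 2 + X 2 ^ 2) + X 0 * X 1 * X 2 := by ring
  rw [h, add_pow]
  refine Finset.sum_congr rfl fun i _ => ?_
  rw [neg_pow, add_pow, Finset.mul_sum, Finset.sum_mul, Finset.sum_mul]
  refine Finset.sum_congr rfl fun j _ => ?_
  rw [← mul_one ((-1) ^ i * n.choose i * i.choose j : R), ← C_mul_monomial, ← one_mul (1 : R),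
    ← monomial_mul, ← one_mul (1 : R), ← monomial_mul]
  simp only [one_mul, ← X_pow_eq_monomial, map_mul, map_pow, map_neg, map_one, map_natCast]
  ring

open MvPolynomial in
theorem MvPolynomial.coeff_sub_sq_sub_sq_pow {R : Type*} [CommRing R] {n i : ℕ} (hi : i ≤ n) :
    coeff (Finsupp.single (0 : Fin 3) (n - i) + Finsupp.single 1 n + Finsupp.single 2 n)
        ((X 0 * X 1 * X 2 - X 1 ^ 2 - X 2 ^ 2 : MvPolynomial (Fin 3) R) ^ n) =
      if Even i then (n.choose i * (i / 2).centralBinom : R) else 0 := by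
  have key (a j : ℕ) (ha : a ≤ n) (hj : j ≤ a) :
      (Finsupp.single (0 : Fin 3) (n - a) + Finsupp.single 1 (n - a + 2 * j) +
        Finsupp.single 2 (n - a + 2 * (a - j)) =
      Finsupp.single 0 (n - i) + Finsupp.single 1 n + Finsupp.single 2 n) ↔
        a = i ∧ i = 2 * j := by
    simp only [Finsupp.ext_iff, Fin.forall_fin_succ, Finsupp.add_apply, Finsupp.single_apply]
    simp
    omega
  simp only [sub_sq_sub_sq_pow_eq_sum, coeff_sum, coeff_monomial]
  rw [Finset.sum_eq_single_of_mem i (by simp; omega)]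
  · split_ifs with h
    · obtain ⟨j, rfl⟩ := h
      rw [Finset.sum_eq_single_of_mem j (by simp), if_pos ((key _ _ hi (by omega)).2 (by omega))]
      · simp [← two_mul, Nat.centralBinom]
      · intro b hb hbj
        rw [Finset.mem_range] at hb
        exact if_neg fun h => hbj (by have := (key _ _ hi (by omega)).1 h; omega)
    · refine Finset.sum_eq_zero fun j hj => if_neg fun hj' => h ?_
      rw [Finset.mem_range] at hj
      exact even_iff_two_dvd.2 ⟨j, ((key _ _ hi (by omega)).1 hj').2⟩
  · intro a ha hai
    rw [Finset.mem_range] at ha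
    refine Finset.sum_eq_zero fun j hj => if_neg fun h => hai ?_
    rw [Finset.mem_range] at hj
    exact ((key _ _ (by omega) (by omega)).1 h).1

open MvPolynomial in
/-- Let `p` be an odd prime. In `𝔽_p[u]` we have
`∑_{k=0}^{p-1} c_k u^k = (u² − 4)^{(p−1)/2}`, where `c_k` is the coefficient of the
monomial `u^k v^{p−1} w^{p−1}` in `(uvw − v² − w²)^{p−1} ∈ 𝔽_p[u, v, w]`. -/
theorem splitting_coefficient_identity (p : ℕ) (hp : p.Prime) (hodd : p ≠ 2) :
    (∑ k ∈ Finset.range p,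
      Polynomial.C (MvPolynomial.coeff
          (Finsupp.single (0 : Fin 3) k + Finsupp.single 1 (p - 1) +
            Finsupp.single 2 (p - 1))
          ((X 0 * X 1 * X 2 - X 1 ^ 2 - X 2 ^ 2 : MvPolynomial (Fin 3) (ZMod p)) ^ (p - 1)))
        * Polynomial.X ^ k)
      = (Polynomial.X ^ 2 - Polynomial.C 4 : Polynomial (ZMod p)) ^ ((p - 1) / 2) := by
  obtain ⟨m, hm⟩ := hp.odd_of_ne_two hodd
  rw [← Finset.sum_range_reflect]
  have hcoeff (i : ℕ) (hi : i ∈ Finset.range p) :=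
    coeff_sub_sq_sub_sq_pow (R := ZMod p) (n := p - 1) (i := i)
      (Nat.le_sub_one_of_lt (Finset.mem_range.1 hi))
  rw [Finset.sum_congr rfl fun i hi => by rw [hcoeff i hi]]
  rw [congrArg Finset.range hm, Finset.sum_range_two_mul_add_one_of_odd_eq_zero _ (by simp),
    show (p - 1) / 2 = m by omega, sub_eq_neg_add, add_pow]
  refine Finset.sum_congr rfl fun j hj => ?_
  rw [Finset.mem_range] at hj
  rw [if_pos (even_two_mul j), ZMod.choose_prime_sub_one hp (by omega),
    Nat.mul_div_cancel_left j two_pos, (even_two_mul j).neg_one_pow, one_mul,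
    ← ZMod.choose_half_mul_neg_four_pow hp hm (by omega), ← pow_mul,
    show p - 1 - 2 * j = 2 * (m - j) by omega]
  simp only [map_mul, map_pow, map_neg, map_natCast]
  ring
end
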